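/- Let k be a non-negative integer and let G be a finite nonempty planar graph with minimum degree at least 2 in which no connected component is a cycle. Suppose that every vertex of degree 3 has at most k 2-weak-neighbors, and that every path in G contains at most (k+1)/2 consecutive vertices of degree 2. Then G contains a cycle of length strictly less than 2k+6 (i.e., G cannot have girth at least 2k+6). -/

import Mathlib

/-- `H` is a minor of `G`: there is a family of nonempty, pairwise disjoint,
connected branch sets in `G`, one for each vertex of `H`, with an edge of `G`
between the branch sets of any two adjacent vertices of `H`. -/
def SimpleGraph.IsMinorOf {W V : Type*} (H : SimpleGraph W) (G : SimpleGraph V) : Prop :=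
  ∃ f : W → Set V,
    (∀ w, (f w).Nonempty) ∧
    (∀ w, (G.induce (f w)).Connected) ∧
    (Pairwise fun w₁ w₂ => Disjoint (f w₁) (f w₂)) ∧
    ∀ ⦃w₁ w₂⦄, H.Adj w₁ w₂ → ∃ v₁ ∈ f w₁, ∃ v₂ ∈ f w₂, G.Adj v₁ v₂

/-- A graph is planar iff it has no `K₅` minor and no `K₃,₃` minor (Wagner's theorem). -/
def SimpleGraph.IsPlanar {V : Type*} (G : SimpleGraph V) : Prop :=
  ¬ (completeGraph (Fin 5)).IsMinorOf G ∧
    ¬ (completeBipartiteGraph (Fin 3) (Fin 3)).IsMinorOf G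

/-- `v` is a weak-neighbor of `u`: there is a path from `u` to `v` all of whose
internal vertices have degree 2. -/
def SimpleGraph.IsWeakNbr {V : Type*} (G : SimpleGraph V) (u v : V) : Prop :=
  u ≠ v ∧ ∃ p : G.Walk u v, p.IsPath ∧
    ∀ x ∈ p.support, x ≠ u → x ≠ v → (G.neighborSet x).ncard = 2

namespace SimpleGraph

section ConnectedSets

variable {V : Type*} {G : SimpleGraph V}

/-- Some edge of `G` joins `S` to `T`. -/
def SetAdj (G : SimpleGraph V) (S T : Set V) : Prop := ∃ a ∈ S, ∃ b ∈ T, G.Adj a b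

lemma SetAdj.symm {S T : Set V} (h : G.SetAdj S T) : G.SetAdj T S := by
  obtain ⟨a, ha, b, hb, hab⟩ := h
  exact ⟨b, hb, a, ha, hab.symm⟩

lemma SetAdj.mono {S T S' T' : Set V} (h : G.SetAdj S T) (hS : S ⊆ S') (hT : T ⊆ T') :
    G.SetAdj S' T' := by
  obtain ⟨a, ha, b, hb, hab⟩ := h
  exact ⟨a, hS ha, b, hT hb, hab⟩

lemma induce_union_connected_of_setAdj {S T : Set V} (hS : (G.induce S).Connected)
    (hT : (G.induce T).Connected) (h : G.SetAdj S T) : (G.induce (S ∪ T)).Connected := by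
  obtain ⟨a, ha, b, hb, hab⟩ := h
  have h1 := induce_union_connected hS.preconnected
    (induce_pair_connected_of_adj hab).preconnected ⟨a, ha, by simp⟩
  have h2 := induce_union_connected h1.preconnected hT.preconnected ⟨b, by simp, hb⟩
  have : S ∪ {a, b} ∪ T = S ∪ T := by
    ext v
    simp only [Set.mem_union, Set.mem_insert_iff, Set.mem_singleton_iff]
    grind
  rwa [this] at h2

lemma induce_singleton_connected (v : V) : (G.induce {v}).Connected := by
  have : Nonempty ({v} : Set V) := ⟨⟨v, rfl⟩⟩
  exact ⟨fun a b => by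
    obtain rfl : a = b := Subtype.ext (a.2.trans b.2.symm)
    exact Reachable.refl _⟩

lemma induce_connected_of_isChain {l : List V} (hl : l.IsChain G.Adj) (hne : l ≠ []) :
    (G.induce {v | v ∈ l}).Connected := by
  induction l with
  | nil => exact absurd rfl hne
  | cons a l ih =>
    cases l with
    | nil =>
      have : {v | v ∈ [a]} = {a} := by ext; simp
      rw [this]
      exact induce_singleton_connected a
    | cons b l =>
      have h := induce_union_connected_of_setAdj (induce_singleton_connected a)
        (ih hl.of_cons (by simp)) ⟨a, rfl, b, by simp, hl.rel⟩
      have : {v | v ∈ a :: b :: l} = {a} ∪ {v | v ∈ b :: l} := by ext; simp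
      rwa [this]

/-- A connected set inside `S` grows to a connected set closed under adjacency within `S`. -/
lemma exists_connected_closed [Finite V] {m S : Set V} (hm : (G.induce m).Connected)
    (hmS : m ⊆ S) : ∃ A, m ⊆ A ∧ A ⊆ S ∧ (G.induce A).Connected ∧
      ∀ b ∈ A, ∀ c ∈ S, G.Adj b c → c ∈ A := by
  obtain ⟨A, ⟨h1, h2, h3⟩, hmax⟩ := Set.Finite.exists_maximal
    (s := {A : Set V | m ⊆ A ∧ A ⊆ S ∧ (G.induce A).Connected}) (Set.toFinite _)
    ⟨m, subset_rfl, hmS, hm⟩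
  refine ⟨A, h1, h2, h3, fun b hb c hc hbc => ?_⟩
  have := hmax (y := A ∪ {c}) ⟨h1.trans Set.subset_union_left,
    Set.union_subset h2 (by simpa using hc),
    induce_union_connected_of_setAdj h3 (induce_singleton_connected c) ⟨b, hb, c, rfl, hbc⟩⟩
    Set.subset_union_left
  exact this (by simp)

lemma exists_adj_of_induce_connected [Finite V] {A T : Set V} (hA : (G.induce A).Connected)
    {a b : V} (ha : a ∈ A) (haT : a ∉ T) (hb : b ∈ A) (hbT : b ∈ T) :
    ∃ u ∈ A, u ∉ T ∧ ∃ v ∈ A, v ∈ T ∧ G.Adj u v := by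
  by_contra! hcon
  have key : ∀ x : A, (G.induce A).Reachable ⟨a, ha⟩ x → x.1 ∉ T := by
    rintro x ⟨p⟩
    have : ∀ (y x : A) (p : (G.induce A).Walk y x), y.1 ∉ T → x.1 ∉ T := by
      intro y x p
      induction p with
      | nil => exact id
      | cons h p ih =>
        intro hy
        exact ih fun hT => hcon _ (Subtype.property _) hy _ (Subtype.property _) hT h
    exact this _ _ p haT
  exact key ⟨b, hb⟩ (hA.preconnected _ _) hbT

lemma IsMinorOf.mono {W : Type*} {K : SimpleGraph W} {H : SimpleGraph V} (h : K.IsMinorOf H)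
    (hHG : H ≤ G) : K.IsMinorOf G := by
  obtain ⟨f, h1, h2, h3, h4⟩ := h
  refine ⟨f, h1, fun w => (h2 w).mono fun a b hab => hHG hab, h3, fun w₁ w₂ hw => ?_⟩
  obtain ⟨a, ha, b, hb, hab⟩ := h4 hw
  exact ⟨a, ha, b, hb, hHG hab⟩

lemma IsPlanar.mono {H : SimpleGraph V} (h : G.IsPlanar) (hHG : H ≤ G) : H.IsPlanar :=
  ⟨fun h' => h.1 (h'.mono hHG), fun h' => h.2 (h'.mono hHG)⟩

lemma not_isPlanar_of_completeBipartite (X Y : Fin 3 → Set V)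
    (hX : ∀ i, (G.induce (X i)).Connected) (hY : ∀ i, (G.induce (Y i)).Connected)
    (hXX : Pairwise fun i j => Disjoint (X i) (X j))
    (hYY : Pairwise fun i j => Disjoint (Y i) (Y j))
    (hXY : ∀ i j, Disjoint (X i) (Y j)) (hadj : ∀ i j, G.SetAdj (X i) (Y j)) :
    ¬ G.IsPlanar := by
  refine fun h => h.2 ⟨Sum.elim X Y, ?_, ?_, ?_, ?_⟩
  · rintro (i | i)
    · exact Set.nonempty_coe_sort.1 (hX i).nonempty
    · exact Set.nonempty_coe_sort.1 (hY i).nonempty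
  · rintro (i | i)
    · exact hX i
    · exact hY i
  · rintro (i | i) (j | j) hij
    · exact hXX (by simpa using hij)
    · exact hXY i j
    · exact (hXY j i).symm
    · exact hYY (by simpa using hij)
  · rintro (i | i) (j | j) hij
    · simp at hij
    · exact hadj i j
    · exact (hadj j i).symm
    · simp at hij

lemma not_isPlanar_of_complete (X : Fin 5 → Set V) (hX : ∀ i, (G.induce (X i)).Connected)
    (hXX : ∀ i j, i < j → Disjoint (X i) (X j)) (hadj : ∀ i j, i < j → G.SetAdj (X i) (X j)) :
    ¬ G.IsPlanar := by
  refine fun h => h.1 ⟨X, fun i => Set.nonempty_coe_sort.1 (hX i).nonempty, hX, ?_, ?_⟩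
  · intro i j hij
    rcases lt_or_gt_of_ne hij with h | h
    · exact hXX i j h
    · exact (hXX j i h).symm
  · intro i j hij
    rcases lt_or_gt_of_ne (show i ≠ j from hij) with h | h
    · exact hadj i j h
    · exact (hadj j i h).symm

end ConnectedSets

end SimpleGraph

namespace SimpleGraph

section ThreePaths

variable {V : Type*} {G : SimpleGraph V}

/-- Every set of vertices off `l` that misses some non-isolated vertex off `l` has an edge
leaving it off `l`: the non-isolated vertices of `G` outside `l` span a connected graph. -/
def NonSeparating (G : SimpleGraph V) (l : List V) : Prop :=
  ∀ B : Set V, (∃ b ∈ B, b ∈ G.support) → (∀ b ∈ B, b ∉ l) →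
    (∃ c ∈ G.support, c ∉ B ∧ c ∉ l) → ∃ b ∈ B, ∃ c, c ∉ B ∧ c ∉ l ∧ G.Adj b c

lemma setAdj_of_isChain {l : List V} (hl : l.IsChain G.Adj) (pre a b post : List V)
    (h : l = pre ++ (a ++ (b ++ post))) (ha : a ≠ []) (hb : b ≠ []) :
    G.SetAdj {v | v ∈ a} {v | v ∈ b} := by
  rw [h, ← List.append_assoc a] at hl
  have h1 : (a ++ b).IsChain G.Adj := hl.right_of_append.left_of_append
  rw [List.isChain_append] at h1
  exact ⟨a.getLast ha, by simp, b.head hb, by simp,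
    h1.2.2 _ (by simp [List.getLast?_eq_getLast_of_ne_nil ha]) _
      (by simp [List.head?_eq_some_head hb])⟩

lemma induce_connected_of_isChain_of_append {l : List V} (hl : l.IsChain G.Adj)
    (pre a post : List V) (h : l = pre ++ (a ++ post)) (ha : a ≠ []) :
    (G.induce {v | v ∈ a}).Connected :=
  induce_connected_of_isChain (h ▸ hl).right_of_append.left_of_append ha

lemma mem_support_of_isChain {l : List V} (hl : l.IsChain G.Adj) (hlen : 2 ≤ l.length) {v : V}
    (hv : v ∈ l) : v ∈ G.support := by
  induction l with
  | nil => simp at hv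
  | cons a l ih =>
    cases l with
    | nil => simp at hlen
    | cons b l =>
      rcases List.mem_cons.1 hv with rfl | hv
      · exact ⟨b, hl.rel⟩
      · cases l with
        | nil =>
          obtain rfl : v = b := by simpa using hv
          exact ⟨a, hl.rel.symm⟩
        | cons c l => exact ih hl.of_cons (by simp) hv

lemma NonSeparating.setAdj {l : List V} (h : G.NonSeparating l) {B T : Set V}
    (hB : ∃ b ∈ B, b ∈ G.support) (hBl : ∀ b ∈ B, b ∉ l)
    (hc : ∃ c ∈ G.support, c ∉ B ∧ c ∉ l)
    (hT : ∀ b ∈ B, ∀ c ∉ B, c ∉ l → G.Adj b c → c ∈ T) : G.SetAdj B T := by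
  obtain ⟨b, hb, c, hcB, hcl, hbc⟩ := h B hB hBl hc
  exact ⟨b, hb, c, hT b hb c hcB hcl hbc, hbc⟩

/-- Two of the three paths stay together longer at the end of the path than the third one. -/
lemma not_isPlanar_of_nested [Finite V] {s u m₁ m₂ m₃ w t : List V}
    (h₁ : (s ++ u ++ m₁ ++ w ++ t).IsChain G.Adj) (h₂ : (s ++ u ++ m₂ ++ w ++ t).IsChain G.Adj)
    (h₃ : (s ++ m₃ ++ t).IsChain G.Adj)
    (n₁ : (s ++ u ++ m₁ ++ w ++ t).Nodup) (n₂ : (s ++ u ++ m₂ ++ w ++ t).Nodup)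
    (n₃ : (s ++ m₃ ++ t).Nodup)
    (d₁₂ : m₁.Disjoint m₂) (d₁₃ : (u ++ m₁ ++ w).Disjoint m₃) (d₂₃ : (u ++ m₂ ++ w).Disjoint m₃)
    (hs : s ≠ []) (ht : t ≠ []) (hw : w ≠ []) (hm₁ : m₁ ≠ []) (hm₂ : m₂ ≠ []) (hm₃ : m₃ ≠ [])
    (hst : G.SetAdj {v | v ∈ s} {v | v ∈ t})
    (p₁ : G.NonSeparating (s ++ u ++ m₁ ++ w ++ t))
    (p₂ : G.NonSeparating (s ++ u ++ m₂ ++ w ++ t)) : ¬ G.IsPlanar := by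
  have supp₁ : ∀ v ∈ m₁, v ∈ G.support := fun v hv => mem_support_of_isChain h₁
    (by have := List.length_pos_of_ne_nil hs; have := List.length_pos_of_ne_nil ht
        simp only [List.length_append]; omega) (by simp [hv])
  have supp₂ : ∀ v ∈ m₂, v ∈ G.support := fun v hv => mem_support_of_isChain h₂
    (by have := List.length_pos_of_ne_nil hs; have := List.length_pos_of_ne_nil ht
        simp only [List.length_append]; omega) (by simp [hv])
  have supp₃ : ∀ v ∈ m₃, v ∈ G.support := fun v hv => mem_support_of_isChain h₃
    (by have := List.length_pos_of_ne_nil hs; have := List.length_pos_of_ne_nil ht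
        simp only [List.length_append]; omega) (by simp [hv])
  obtain ⟨v₁, hv₁⟩ := List.exists_mem_of_ne_nil _ hm₁
  obtain ⟨v₂, hv₂⟩ := List.exists_mem_of_ne_nil _ hm₂
  obtain ⟨v₃, hv₃⟩ := List.exists_mem_of_ne_nil _ hm₃
  have su : (G.induce {v | v ∈ s ++ u}).Connected :=
    induce_connected_of_isChain_of_append h₁ [] (s ++ u) (m₁ ++ w ++ t) (by simp) (by simp [hs])
  have cm₁ := induce_connected_of_isChain_of_append h₁ (s ++ u) m₁ (w ++ t) (by simp) hm₁
  have cm₂ := induce_connected_of_isChain_of_append h₂ (s ++ u) m₂ (w ++ t) (by simp) hm₂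
  have cm₃ := induce_connected_of_isChain_of_append h₃ s m₃ t (by simp) hm₃
  have cw := induce_connected_of_isChain_of_append h₁ (s ++ u ++ m₁) w t (by simp) hw
  have ct := induce_connected_of_isChain_of_append h₁ (s ++ u ++ m₁ ++ w) t [] (by simp) ht
  have a1 := setAdj_of_isChain h₁ [] (s ++ u) m₁ (w ++ t) (by simp) (by simp [hs]) hm₁
  have a2 := setAdj_of_isChain h₂ [] (s ++ u) m₂ (w ++ t) (by simp) (by simp [hs]) hm₂
  have a3 := (setAdj_of_isChain h₁ (s ++ u) m₁ w t (by simp) hm₁ hw).symm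
  have a4 := (setAdj_of_isChain h₂ (s ++ u) m₂ w t (by simp) hm₂ hw).symm
  have a5 := setAdj_of_isChain h₁ (s ++ u ++ m₁) w t [] (by simp) hw ht
  have a6 := setAdj_of_isChain h₃ s m₃ t [] (by simp) hm₃ ht
  simp only [List.nodup_append, List.Disjoint, List.mem_append] at n₁ n₂ n₃ d₁₂ d₁₃ d₂₃
  obtain ⟨A, hmA, hAS, hAc, hAcl⟩ := exists_connected_closed (G := G) (m := {v | v ∈ m₃})
    (S := {v | v ∉ s ++ u ++ m₁ ++ w ++ t ∧ v ∉ s ++ u ++ m₂ ++ w ++ t}) cm₃ (by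
      intro v hv
      simp only [List.mem_append, Set.mem_ofPred_eq] at hv ⊢
      grind)
  simp only [Set.subset_def, List.mem_append, Set.mem_ofPred_eq] at hAS hAcl hmA
  have b1 : G.SetAdj A {v | v ∈ m₁} := by
    refine p₂.setAdj ⟨v₃, hmA _ hv₃, supp₃ _ hv₃⟩ ?_ ⟨v₁, supp₁ _ hv₁, ?_, ?_⟩ ?_
    · grind
    · grind
    · grind
    · intro b hb c hc hcl hbc
      have := hAcl b hb c
      simp only [List.mem_append, Set.mem_ofPred_eq] at hcl ⊢
      grind
  have b2 : G.SetAdj A {v | v ∈ m₂} := by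
    refine p₁.setAdj ⟨v₃, hmA _ hv₃, supp₃ _ hv₃⟩ ?_ ⟨v₂, supp₂ _ hv₂, ?_, ?_⟩ ?_
    · grind
    · grind
    · grind
    · intro b hb c hc hcl hbc
      have := hAcl b hb c
      simp only [List.mem_append, Set.mem_ofPred_eq] at hcl ⊢
      grind
  apply not_isPlanar_of_completeBipartite ![{v | v ∈ s ++ u}, {v | v ∈ w}, A]
    ![{v | v ∈ m₁}, {v | v ∈ m₂}, {v | v ∈ t}]
  · simp [Fin.forall_fin_succ, su, cw, hAc]
  · simp [Fin.forall_fin_succ, cm₁, cm₂, ct]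
  · simp only [Pairwise, Fin.forall_fin_succ, Set.disjoint_left]
    simp
    grind
  · simp only [Pairwise, Fin.forall_fin_succ, Set.disjoint_left]
    simp
    grind
  · simp only [Fin.forall_fin_succ, Set.disjoint_left]
    simp
    grind
  · have a0 : G.SetAdj {v | v ∈ s ++ u} {v | v ∈ t} :=
      hst.mono (fun v hv => by simp_all) subset_rfl
    have a6' : G.SetAdj A {v | v ∈ t} := a6.mono hmA subset_rfl
    simp only [Fin.forall_fin_succ]
    simp [-List.mem_append, *]

/-- One of the three paths stays together with the second one at the start and with the third one
at the end. -/
lemma not_isPlanar_of_crossing [Finite V] {s u m₁ m₂ m₃ w t : List V}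
    (h₁ : (s ++ u ++ m₁ ++ w ++ t).IsChain G.Adj) (h₂ : (s ++ u ++ m₂ ++ t).IsChain G.Adj)
    (h₃ : (s ++ m₃ ++ w ++ t).IsChain G.Adj)
    (n₁ : (s ++ u ++ m₁ ++ w ++ t).Nodup) (n₂ : (s ++ u ++ m₂ ++ t).Nodup)
    (n₃ : (s ++ m₃ ++ w ++ t).Nodup)
    (d₁₂ : (m₁ ++ w).Disjoint m₂) (d₁₃ : (u ++ m₁).Disjoint m₃)
    (d₂₃ : (u ++ m₂).Disjoint (m₃ ++ w))
    (hs : s ≠ []) (ht : t ≠ []) (hu : u ≠ []) (hw : w ≠ []) (hm₂ : m₂ ≠ []) (hm₃ : m₃ ≠ [])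
    (hst : G.SetAdj {v | v ∈ s} {v | v ∈ t})
    (p₁ : G.NonSeparating (s ++ u ++ m₁ ++ w ++ t)) : ¬ G.IsPlanar := by
  have supp₂ : ∀ v ∈ m₂, v ∈ G.support := fun v hv => mem_support_of_isChain h₂
    (by have := List.length_pos_of_ne_nil hs; have := List.length_pos_of_ne_nil ht
        simp only [List.length_append]; omega) (by simp [hv])
  have supp₃ : ∀ v ∈ m₃, v ∈ G.support := fun v hv => mem_support_of_isChain h₃
    (by have := List.length_pos_of_ne_nil hs; have := List.length_pos_of_ne_nil ht
        simp only [List.length_append]; omega) (by simp [hv])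
  obtain ⟨v₂, hv₂⟩ := List.exists_mem_of_ne_nil _ hm₂
  obtain ⟨v₃, hv₃⟩ := List.exists_mem_of_ne_nil _ hm₃
  have cs := induce_connected_of_isChain_of_append h₁ [] s (u ++ m₁ ++ w ++ t) (by simp) hs
  have cu := induce_connected_of_isChain_of_append h₁ s u (m₁ ++ w ++ t) (by simp) hu
  have cw := induce_connected_of_isChain_of_append h₁ (s ++ u) (m₁ ++ w) t (by simp) (by simp [hw])
  have ct := induce_connected_of_isChain_of_append h₁ (s ++ u ++ m₁ ++ w) t [] (by simp) ht
  have cm₂ := induce_connected_of_isChain_of_append h₂ (s ++ u) m₂ t (by simp) hm₂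
  have cm₃ := induce_connected_of_isChain_of_append h₃ s m₃ (w ++ t) (by simp) hm₃
  have a1 := (setAdj_of_isChain h₁ [] s u (m₁ ++ w ++ t) (by simp) hs hu).symm
  have a2 := setAdj_of_isChain h₁ s u (m₁ ++ w) t (by simp) hu (by simp [hw])
  have a3 := setAdj_of_isChain h₂ s u m₂ t (by simp) hu hm₂
  have a4 := (setAdj_of_isChain h₁ (s ++ u) (m₁ ++ w) t [] (by simp) (by simp [hw]) ht).symm
  have a5 := (setAdj_of_isChain h₂ (s ++ u) m₂ t [] (by simp) hm₂ ht).symm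
  have a6 := (setAdj_of_isChain h₃ [] s m₃ (w ++ t) (by simp) hs hm₃).symm
  have a7 := setAdj_of_isChain h₃ s m₃ w t (by simp) hm₃ hw
  simp only [List.nodup_append, List.Disjoint, List.mem_append] at n₁ n₂ n₃ d₁₂ d₁₃ d₂₃
  obtain ⟨A, hmA, hAS, hAc, hAcl⟩ := exists_connected_closed (G := G) (m := {v | v ∈ m₃})
    (S := {v | v ∉ s ++ u ++ m₁ ++ w ++ t ∧ v ∉ s ++ u ++ m₂ ++ t}) cm₃ (by
      intro v hv
      simp only [List.mem_append, Set.mem_ofPred_eq] at hv ⊢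
      grind)
  have a6' : G.SetAdj A {v | v ∈ s} := a6.mono hmA subset_rfl
  have a7' : G.SetAdj A {v | v ∈ m₁ ++ w} := a7.mono hmA (fun v hv => by simp_all)
  simp only [Set.subset_def, List.mem_append, Set.mem_ofPred_eq] at hAS hAcl hmA
  have b2 : G.SetAdj A {v | v ∈ m₂} := by
    refine p₁.setAdj ⟨v₃, hmA _ hv₃, supp₃ _ hv₃⟩ ?_ ⟨v₂, supp₂ _ hv₂, ?_, ?_⟩ ?_
    · grind
    · grind
    · grind
    · intro b hb c hc hcl hbc
      have := hAcl b hb c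
      simp only [List.mem_append, Set.mem_ofPred_eq] at hcl ⊢
      grind
  apply not_isPlanar_of_completeBipartite ![{v | v ∈ u}, {v | v ∈ t}, A]
    ![{v | v ∈ s}, {v | v ∈ m₁ ++ w}, {v | v ∈ m₂}]
  · simp [Fin.forall_fin_succ, cu, ct, hAc]
  · simp only [Fin.forall_fin_succ]
    simp [-List.mem_append, cm₂, cs, cw]
  · simp only [Pairwise, Fin.forall_fin_succ, Set.disjoint_left]
    simp
    grind
  · simp only [Pairwise, Fin.forall_fin_succ, Set.disjoint_left]
    simp
    grind
  · simp only [Fin.forall_fin_succ, Set.disjoint_left]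
    simp
    grind
  · have a0 := hst.symm
    simp only [Fin.forall_fin_succ]
    simp [-List.mem_append, *]

/-- The three paths separate at the same vertex and meet again at the same vertex. -/
lemma not_isPlanar_of_parallel [Finite V] {s m₁ m₂ m₃ t : List V}
    (h₁ : (s ++ m₁ ++ t).IsChain G.Adj) (h₂ : (s ++ m₂ ++ t).IsChain G.Adj)
    (h₃ : (s ++ m₃ ++ t).IsChain G.Adj)
    (n₁ : (s ++ m₁ ++ t).Nodup) (n₂ : (s ++ m₂ ++ t).Nodup) (n₃ : (s ++ m₃ ++ t).Nodup)
    (d₁₂ : m₁.Disjoint m₂) (d₁₃ : m₁.Disjoint m₃) (d₂₃ : m₂.Disjoint m₃)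
    (hs : s ≠ []) (ht : t ≠ []) (hm₁ : m₁ ≠ []) (hm₂ : m₂ ≠ []) (hm₃ : m₃ ≠ [])
    (hst : G.SetAdj {v | v ∈ s} {v | v ∈ t})
    (p₁ : G.NonSeparating (s ++ m₁ ++ t)) (p₂ : G.NonSeparating (s ++ m₂ ++ t))
    (p₃ : G.NonSeparating (s ++ m₃ ++ t)) : ¬ G.IsPlanar := by
  have supp : ∀ m : List V, (s ++ m ++ t).IsChain G.Adj → ∀ v ∈ m, v ∈ G.support :=
    fun m hm v hv => mem_support_of_isChain hm
    (by have := List.length_pos_of_ne_nil hs; have := List.length_pos_of_ne_nil ht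
        simp only [List.length_append]; omega) (by simp [hv])
  have supp₁ := supp _ h₁
  have supp₂ := supp _ h₂
  have supp₃ := supp _ h₃
  obtain ⟨v₁, hv₁⟩ := List.exists_mem_of_ne_nil _ hm₁
  obtain ⟨v₂, hv₂⟩ := List.exists_mem_of_ne_nil _ hm₂
  obtain ⟨v₃, hv₃⟩ := List.exists_mem_of_ne_nil _ hm₃
  have cs := induce_connected_of_isChain_of_append h₁ [] s (m₁ ++ t) (by simp) hs
  have ct := induce_connected_of_isChain_of_append h₁ (s ++ m₁) t [] (by simp) ht
  have cm₁ := induce_connected_of_isChain_of_append h₁ s m₁ t (by simp) hm₁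
  have cm₂ := induce_connected_of_isChain_of_append h₂ s m₂ t (by simp) hm₂
  have cm₃ := induce_connected_of_isChain_of_append h₃ s m₃ t (by simp) hm₃
  have s1 := setAdj_of_isChain h₁ [] s m₁ t (by simp) hs hm₁
  have s2 := setAdj_of_isChain h₂ [] s m₂ t (by simp) hs hm₂
  have s3 := setAdj_of_isChain h₃ [] s m₃ t (by simp) hs hm₃
  have t1 := (setAdj_of_isChain h₁ s m₁ t [] (by simp) hm₁ ht).symm
  have t2 := (setAdj_of_isChain h₂ s m₂ t [] (by simp) hm₂ ht).symm
  have t3 := (setAdj_of_isChain h₃ s m₃ t [] (by simp) hm₃ ht).symm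
  simp only [List.nodup_append, List.Disjoint, List.mem_append] at n₁ n₂ n₃ d₁₂ d₁₃ d₂₃
  by_cases hT : ∃ T : Set V, (G.induce T).Connected ∧
      (∀ v ∈ T, v ∉ s ∧ v ∉ t ∧ v ∉ m₁ ∧ v ∉ m₂ ∧ v ∉ m₃) ∧ G.SetAdj T {v | v ∈ m₁} ∧
      G.SetAdj T {v | v ∈ m₂} ∧ G.SetAdj T {v | v ∈ m₃}
  · obtain ⟨T, cT, hTF, T1, T2, T3⟩ := hT
    apply not_isPlanar_of_completeBipartite ![{v | v ∈ s}, {v | v ∈ t}, T]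
      ![{v | v ∈ m₁}, {v | v ∈ m₂}, {v | v ∈ m₃}]
    · simp [Fin.forall_fin_succ, *]
    · simp [Fin.forall_fin_succ, *]
    · simp only [Pairwise, Fin.forall_fin_succ, Set.disjoint_left]
      simp
      grind
    · simp only [Pairwise, Fin.forall_fin_succ, Set.disjoint_left]
      simp
      grind
    · simp only [Fin.forall_fin_succ, Set.disjoint_left]
      simp
      grind
    · simp only [Fin.forall_fin_succ]
      simp [*]
  push Not at hT
  obtain ⟨A, hmA, hAS, hAc, hAcl⟩ := exists_connected_closed (G := G) (m := {v | v ∈ m₁})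
    (S := {v | v ∉ s ++ m₂ ++ t ∧ v ∉ s ++ m₃ ++ t}) cm₁ (by
      intro v hv
      simp only [List.mem_append, Set.mem_ofPred_eq] at hv ⊢
      grind)
  have sA := s1.mono subset_rfl hmA
  have tA := t1.mono subset_rfl hmA
  simp only [Set.subset_def, List.mem_append, Set.mem_ofPred_eq] at hAS hAcl hmA
  have A2 : G.SetAdj A {v | v ∈ m₂} := by
    refine p₃.setAdj ⟨v₁, hmA _ hv₁, supp₁ _ hv₁⟩ ?_ ⟨v₂, supp₂ _ hv₂, ?_, ?_⟩ ?_
    · grind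
    · grind
    · grind
    · intro b hb c hc hcl hbc
      have := hAcl b hb c
      simp only [List.mem_append, Set.mem_ofPred_eq] at hcl ⊢
      grind
  have A3 : G.SetAdj A {v | v ∈ m₃} := by
    refine p₂.setAdj ⟨v₁, hmA _ hv₁, supp₁ _ hv₁⟩ ?_ ⟨v₃, supp₃ _ hv₃, ?_, ?_⟩ ?_
    · grind
    · grind
    · grind
    · intro b hb c hc hcl hbc
      have := hAcl b hb c
      simp only [List.mem_append, Set.mem_ofPred_eq] at hcl ⊢
      grind
  obtain ⟨M, cM, hmM, hMd, hM3⟩ : ∃ M : Set V, (G.induce M).Connected ∧ {v | v ∈ m₂} ⊆ M ∧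
      (∀ v ∈ M, v ∉ s ∧ v ∉ t ∧ v ∉ m₃ ∧ v ∉ A) ∧ G.SetAdj M {v | v ∈ m₃} := by
    obtain ⟨D, hmD, hDS, hDc, hDcl⟩ := exists_connected_closed (G := G) (m := {v | v ∈ m₂})
      (S := {v | v ∉ s ++ m₁ ++ t ∧ v ∉ s ++ m₃ ++ t}) cm₂ (by
        intro v hv
        simp only [List.mem_append, Set.mem_ofPred_eq] at hv ⊢
        grind)
    simp only [Set.subset_def, List.mem_append, Set.mem_ofPred_eq] at hDS hDcl hmD
    have D3 : G.SetAdj D {v | v ∈ m₃} := by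
      refine p₁.setAdj ⟨v₂, hmD _ hv₂, supp₂ _ hv₂⟩ ?_ ⟨v₃, supp₃ _ hv₃, ?_, ?_⟩ ?_
      · grind
      · grind
      · grind
      · intro b hb c hc hcl hbc
        have := hDcl b hb c
        simp only [List.mem_append, Set.mem_ofPred_eq] at hcl ⊢
        grind
    obtain ⟨b, hbD, c, hc, hbc⟩ := D3
    simp only [Set.mem_ofPred_eq] at hc
    by_cases hb : b ∈ m₂
    · exact ⟨{v | v ∈ m₂}, cm₂, subset_rfl, by grind, b, hb, c, hc, hbc⟩
    obtain ⟨T, hbT, hTF, cT, hTcl⟩ := exists_connected_closed (G := G) (m := {b})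
      (S := {v | v ∉ s ∧ v ∉ t ∧ v ∉ m₁ ∧ v ∉ m₂ ∧ v ∉ m₃}) (induce_singleton_connected b) (by
        intro v hv
        simp only [Set.mem_singleton_iff, Set.mem_ofPred_eq] at hv ⊢
        grind)
    simp only [Set.subset_def, Set.mem_singleton_iff, forall_eq, Set.mem_ofPred_eq]
      at hbT hTF hTcl
    have T3 : G.SetAdj T {v | v ∈ m₃} := ⟨b, hbT, c, hc, hbc⟩
    have T2 : G.SetAdj T {v | v ∈ m₂} := by
      obtain ⟨x, hxD, hxT, y, hyD, hyT, hxy⟩ := exists_adj_of_induce_connected (T := T) hDc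
        (hmD _ hv₂) (fun h => (hTF _ h).2.2.2.1 hv₂) hbD hbT
      refine ⟨y, hyT, x, ?_, hxy.symm⟩
      have := hTcl y hyT x
      have := hxy.symm
      simp only [Set.mem_ofPred_eq]
      grind
    have TA : ∀ v ∈ T, v ∉ A := by
      intro v hvT hvA
      obtain ⟨x, hxA, hxT, y, hyA, hyT, hxy⟩ := exists_adj_of_induce_connected (T := T) hAc
        (hmA _ hv₁) (fun h => (hTF _ h).2.2.1 hv₁) hvA hvT
      refine hT T cT hTF ⟨y, hyT, x, ?_, hxy.symm⟩ T2 T3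
      have := hTcl y hyT x
      have := hxy.symm
      simp only [Set.mem_ofPred_eq]
      grind
    refine ⟨{v | v ∈ m₂} ∪ T, induce_union_connected_of_setAdj cm₂ cT T2.symm,
      Set.subset_union_left, ?_, T3.mono Set.subset_union_right subset_rfl⟩
    rintro v (hv | hv)
    · simp only [Set.mem_ofPred_eq] at hv
      grind
    · grind
  have sM := s2.mono subset_rfl hmM
  have tM := t2.mono subset_rfl hmM
  have AM := A2.mono subset_rfl hmM
  apply not_isPlanar_of_complete ![{v | v ∈ s}, {v | v ∈ t}, A, M, {v | v ∈ m₃}]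
  · simp [Fin.forall_fin_succ, *]
  · simp only [Fin.forall_fin_succ, Set.disjoint_left]
    simp
    grind
  · simp only [Fin.forall_fin_succ]
    simp [*]

end ThreePaths

end SimpleGraph

section ListFork

variable {α : Type*}

/-- `l` and `l'` share the initial part `s` and the final part `t`, and are disjoint between. -/
structure ListFork (l l' s m m' t : List α) : Prop where
  left_eq : l = s ++ m ++ t
  right_eq : l' = s ++ m' ++ t
  disjoint : m.Disjoint m'
  start_ne : s ≠ []
  end_ne : t ≠ []
  left_ne : m ≠ []
  right_ne : m' ≠ []

namespace ListFork

variable {l l' s m m' t : List α}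

lemma symm (h : ListFork l l' s m m' t) : ListFork l' l s m' m t :=
  ⟨h.right_eq, h.left_eq, h.disjoint.symm, h.start_ne, h.end_ne, h.right_ne, h.left_ne⟩

lemma reverse (h : ListFork l l' s m m' t) :
    ListFork l.reverse l'.reverse t.reverse m.reverse m'.reverse s.reverse := by
  refine ⟨by simp [h.left_eq], by simp [h.right_eq], ?_, by simp [h.end_ne], by simp [h.start_ne],
    by simp [h.left_ne], by simp [h.right_ne]⟩
  intro a ha ha'
  exact h.disjoint (by simpa using ha) (by simpa using ha')

lemma isPrefix_of_isPrefix (h : ListFork l l' s m m' t) {p : List α} (hp : p <+: l)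
    (hp' : p <+: l') : p <+: s := by
  have hs : s <+: l := ⟨m ++ t, by simp [h.left_eq]⟩
  rcases le_total p.length s.length with hle | hle
  · exact List.prefix_of_prefix_length_le hp hs hle
  obtain ⟨q, rfl⟩ := List.prefix_of_prefix_length_le hs hp hle
  cases q with
  | nil => simp
  | cons c q =>
    exfalso
    have h1 := h.left_eq ▸ hp
    have h2 := h.right_eq ▸ hp'
    have n1 := h.left_ne
    have n2 := h.right_ne
    have hd := h.disjoint
    cases m with
    | nil => exact n1 rfl
    | cons a m =>
      cases m' with
      | nil => exact n2 rfl
      | cons b m' =>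
        simp only [List.append_assoc, List.prefix_append_right_inj, List.cons_append,
          List.cons_prefix_cons] at h1 h2
        obtain ⟨rfl, -⟩ := h1
        obtain ⟨rfl, -⟩ := h2
        exact hd (a := c) (by simp) (by simp)

lemma start_prefix_left (h : ListFork l l' s m m' t) : s <+: l := ⟨m ++ t, by simp [h.left_eq]⟩

variable {l'' s₁₂ m₁₂ m₂₁ t₁₂ s₁₃ m₁₃ m₃₁ t₁₃ s₂₃ m₂₃ m₃₂ t₂₃ : List α}

lemma start_eq_of_length_le (h₁₂ : ListFork l l' s₁₂ m₁₂ m₂₁ t₁₂)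
    (h₁₃ : ListFork l l'' s₁₃ m₁₃ m₃₁ t₁₃) (h₂₃ : ListFork l' l'' s₂₃ m₂₃ m₃₂ t₂₃)
    (h : s₁₃.length ≤ s₁₂.length) (h' : s₂₃.length ≤ s₁₂.length) :
    s₂₃ = s₁₃ ∧ ∃ u, s₁₂ = s₁₃ ++ u := by
  have p1 : s₁₃ <+: s₁₂ :=
    List.prefix_of_prefix_length_le h₁₃.start_prefix_left h₁₂.start_prefix_left h
  have p2 : s₂₃ <+: s₁₂ :=
    List.prefix_of_prefix_length_le h₂₃.start_prefix_left h₁₂.symm.start_prefix_left h'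
  have p3 : s₁₃ <+: s₂₃ := h₂₃.isPrefix_of_isPrefix
    (p1.trans h₁₂.symm.start_prefix_left) h₁₃.symm.start_prefix_left
  have p4 : s₂₃ <+: s₁₃ := h₁₃.isPrefix_of_isPrefix
    (p2.trans h₁₂.start_prefix_left) h₂₃.symm.start_prefix_left
  refine ⟨(p4.eq_of_length_le p3.length_le), ?_⟩
  obtain ⟨u, hu⟩ := p1
  exact ⟨u, hu.symm⟩

lemma end_eq_of_length_le (h₁₂ : ListFork l l' s₁₂ m₁₂ m₂₁ t₁₂)
    (h₁₃ : ListFork l l'' s₁₃ m₁₃ m₃₁ t₁₃) (h₂₃ : ListFork l' l'' s₂₃ m₂₃ m₃₂ t₂₃)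
    (h : t₁₃.length ≤ t₁₂.length) (h' : t₂₃.length ≤ t₁₂.length) :
    t₂₃ = t₁₃ ∧ ∃ w, t₁₂ = w ++ t₁₃ := by
  obtain ⟨h1, u, hu⟩ := start_eq_of_length_le h₁₂.reverse h₁₃.reverse h₂₃.reverse
    (by simpa using h) (by simpa using h')
  refine ⟨List.reverse_injective h1, u.reverse, ?_⟩
  rw [← List.reverse_reverse t₁₂, hu]
  simp

end ListFork

lemma exists_maximal_common_start (l l' : List α) : ∃ s r r', l = s ++ r ∧ l' = s ++ r' ∧
    ∀ a ∈ r.head?, ∀ b ∈ r'.head?, a ≠ b := by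
  induction l generalizing l' with
  | nil => exact ⟨[], [], l', by simp, by simp, by simp⟩
  | cons a l ih =>
    cases l' with
    | nil => exact ⟨[], a :: l, [], by simp, by simp, by simp⟩
    | cons b l' =>
      by_cases h : a = b
      · subst h
        obtain ⟨s, r, r', h1, h2, h3⟩ := ih l'
        exact ⟨a :: s, r, r', by simp [h1], by simp [h2], h3⟩
      · exact ⟨[], a :: l, b :: l', by simp, by simp, by simpa using h⟩

lemma exists_common_suffix (l l' : List α) : ∃ t r r', l = r ++ t ∧ l' = r' ++ t ∧
    ∀ a ∈ r.getLast?, ∀ b ∈ r'.getLast?, a ≠ b := by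
  obtain ⟨s, r, r', h1, h2, h3⟩ := exists_maximal_common_start l.reverse l'.reverse
  refine ⟨s.reverse, r.reverse, r'.reverse, ?_, ?_, by simpa using h3⟩
  · rw [← List.reverse_reverse l, h1]; simp
  · rw [← List.reverse_reverse l', h2]; simp

lemma exists_listFork {l l' : List α} (hne : l ≠ l') (hn : l.Nodup) (hn' : l'.Nodup) {x y : α}
    (hx : ∃ r, l = x :: r) (hx' : ∃ r, l' = x :: r) (hy : ∃ r, l = r ++ [y])
    (hy' : ∃ r, l' = r ++ [y])
    (hmeet : ∀ z P Q P' Q', l = P ++ z :: Q → l' = P' ++ z :: Q' → P = P' ∨ Q = Q')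
    (hmid : ∀ S M T, S ≠ [] → T ≠ [] → l = S ++ T → l' = S ++ M ++ T → M = [])
    (hmid' : ∀ S M T, S ≠ [] → T ≠ [] → l' = S ++ T → l = S ++ M ++ T → M = []) :
    ∃ s m m' t, ListFork l l' s m m' t := by
  obtain ⟨s, r, r', h1, h2, h3⟩ := exists_maximal_common_start l l'
  obtain ⟨t, m, m', h4, h5, h6⟩ := exists_common_suffix r r'
  subst h4 h5
  have hs : s ≠ [] := by
    rintro rfl
    obtain ⟨q, hq⟩ := hx
    obtain ⟨q', hq'⟩ := hx'
    have e1 := h1.symm.trans hq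
    have e2 := h2.symm.trans hq'
    simp only [List.nil_append] at e1 e2
    rw [e1, e2] at h3
    simp at h3
  obtain ⟨r1, hr1⟩ := hy
  obtain ⟨r2, hr2⟩ := hy'
  have hr : m ++ t ≠ [] ∧ m' ++ t ≠ [] := by
    constructor
    · intro h
      obtain ⟨rfl, rfl⟩ := List.append_eq_nil_iff.1 h
      have e : s = r1 ++ [y] := by simpa [h1] using hr1
      rcases List.eq_nil_or_concat' m' with rfl | ⟨q, b, rfl⟩
      · exact hne (by simp [h1, h2])
      · have e2 : s ++ q ++ [b] = r2 ++ [y] := by simpa [h2] using hr2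
        obtain ⟨-, rfl⟩ := by simpa using List.append_inj' e2 rfl
        rw [h2, e] at hn'
        simp [List.nodup_append] at hn'
    · intro h
      obtain ⟨rfl, rfl⟩ := List.append_eq_nil_iff.1 h
      have e : s = r2 ++ [y] := by simpa [h2] using hr2
      rcases List.eq_nil_or_concat' m with rfl | ⟨q, b, rfl⟩
      · exact hne (by simp [h1, h2])
      · have e2 : s ++ q ++ [b] = r1 ++ [y] := by simpa [h1] using hr1
        obtain ⟨-, rfl⟩ := by simpa using List.append_inj' e2 rfl
        rw [h1, e] at hn
        simp [List.nodup_append] at hn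
  have ht : t ≠ [] := by
    rintro rfl
    simp only [List.append_nil] at *
    rcases List.eq_nil_or_concat' m with rfl | ⟨q, b, rfl⟩
    · exact hr.1 rfl
    rcases List.eq_nil_or_concat' m' with rfl | ⟨q', b', rfl⟩
    · exact hr.2 rfl
    have e1 : (s ++ q) ++ [b] = r1 ++ [y] := by simpa [h1] using hr1
    have e2 : (s ++ q') ++ [b'] = r2 ++ [y] := by simpa [h2] using hr2
    obtain ⟨-, rfl⟩ := by simpa using List.append_inj' e1 rfl
    obtain ⟨-, rfl⟩ := by simpa using List.append_inj' e2 rfl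
    simp at h6
  rw [← List.append_assoc] at h1 h2
  refine ⟨s, m, m', t, h1, h2, ?_, hs, ht, ?_, ?_⟩
  · intro z hz hz'
    obtain ⟨P, Q, rfl⟩ := List.append_of_mem hz
    obtain ⟨P', Q', rfl⟩ := List.append_of_mem hz'
    rcases hmeet z (s ++ P) (Q ++ t) (s ++ P') (Q' ++ t) (by simp [h1]) (by simp [h2]) with h | h
    · obtain rfl : P = P' := by simpa using h
      cases P <;> simp at h3
    · obtain rfl : Q = Q' := by simpa using h
      rcases List.eq_nil_or_concat' Q with rfl | ⟨q, b, rfl⟩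
      · simp at h6
      · have e : ∀ P : List α, b ∈ (P ++ z :: (q ++ [b])).getLast? := fun P => by
          rw [Option.mem_def, List.getLast?_eq_some_iff]
          exact ⟨P ++ z :: q, by simp⟩
        exact h6 b (e P) b (e P') rfl
  · rintro rfl
    obtain rfl := hmid s m' t hs ht (by simpa using h1) h2
    exact hne (by simp [h1, h2])
  · rintro rfl
    obtain rfl := hmid' s m t hs ht (by simpa using h2) h1
    exact hne (by simp [h1, h2])

end ListFork

namespace SimpleGraph

section ThreePaths

variable {V : Type*} {G : SimpleGraph V}

lemma NonSeparating.of_perm {l l' : List V} (h : G.NonSeparating l) (hl : ∀ v, v ∈ l ↔ v ∈ l') :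
    G.NonSeparating l' := by
  intro B
  have := h B
  simpa only [hl] using this

/-- A family of paths from `x` to `y` behaving like the shortest such paths. -/
structure IsPathFamily (G : SimpleGraph V) (x y : V) (F : Set (List V)) : Prop where
  adj : G.Adj x y
  chain : ∀ l ∈ F, l.IsChain G.Adj
  nodup : ∀ l ∈ F, l.Nodup
  start_eq : ∀ l ∈ F, ∃ r, l = x :: r
  end_eq : ∀ l ∈ F, ∃ r, l = r ++ [y]
  nonSeparating : ∀ l ∈ F, G.NonSeparating l
  meet : ∀ l ∈ F, ∀ l' ∈ F, ∀ z P Q P' Q', l = P ++ z :: Q → l' = P' ++ z :: Q' → P = P' ∨ Q = Q'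
  middle : ∀ l ∈ F, ∀ l' ∈ F, ∀ S M T, S ≠ [] → T ≠ [] → l = S ++ T → l' = S ++ M ++ T → M = []

namespace IsPathFamily

variable {x y : V} {F : Set (List V)} {l₁ l₂ l₃ : List V}
  {s₁₂ m₁₂ m₂₁ t₁₂ s₁₃ m₁₃ m₃₁ t₁₃ s₂₃ m₂₃ m₃₂ t₂₃ : List V}

lemma setAdj (hF : G.IsPathFamily x y F) {l s m t : List V} (hl : l ∈ F) (h : l = s ++ m ++ t)
    (hs : s ≠ []) (ht : t ≠ []) : G.SetAdj {v | v ∈ s} {v | v ∈ t} := by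
  obtain ⟨r, hr⟩ := hF.start_eq l hl
  obtain ⟨r', hr'⟩ := hF.end_eq l hl
  refine ⟨x, ?_, y, ?_, hF.adj⟩
  · cases s with
    | nil => exact absurd rfl hs
    | cons a s =>
      rw [h] at hr
      simp only [List.cons_append, List.cons.injEq] at hr
      simp [hr.1]
  · rcases List.eq_nil_or_concat' t with rfl | ⟨q, b, rfl⟩
    · exact absurd rfl ht
    · have e : (s ++ m ++ q) ++ [b] = r' ++ [y] := by rw [← hr', h]; simp
      obtain ⟨-, rfl⟩ := by simpa using List.append_inj' e rfl
      simp

lemma not_isPlanar_of_nested [Finite V] (hF : G.IsPathFamily x y F) (h₁ : l₁ ∈ F) (h₂ : l₂ ∈ F)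
    (h₃ : l₃ ∈ F) (f₁₂ : ListFork l₁ l₂ s₁₂ m₁₂ m₂₁ t₁₂) (f₁₃ : ListFork l₁ l₃ s₁₃ m₁₃ m₃₁ t₁₃)
    (f₂₃ : ListFork l₂ l₃ s₂₃ m₂₃ m₃₂ t₂₃)
    (hs : s₁₃.length ≤ s₁₂.length) (hs' : s₂₃.length ≤ s₁₂.length)
    (ht : t₁₃.length ≤ t₁₂.length) (ht' : t₂₃.length ≤ t₁₂.length) : ¬ G.IsPlanar := by
  obtain ⟨rfl, u, rfl⟩ := f₁₂.start_eq_of_length_le f₁₃ f₂₃ hs hs'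
  obtain ⟨rfl, w, rfl⟩ := f₁₂.end_eq_of_length_le f₁₃ f₂₃ ht ht'
  obtain rfl : m₁₃ = u ++ m₁₂ ++ w := by
    have := f₁₃.left_eq.symm.trans f₁₂.left_eq
    have := by simpa [← List.append_assoc] using this
    simpa [List.append_assoc] using this
  obtain rfl : m₂₃ = u ++ m₂₁ ++ w := by
    have := f₂₃.left_eq.symm.trans f₁₂.right_eq
    have := by simpa [← List.append_assoc] using this
    simpa [List.append_assoc] using this
  obtain rfl : m₃₂ = m₃₁ := by
    have := f₂₃.right_eq.symm.trans f₁₃.right_eq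
    simpa [← List.append_assoc] using this
  have e₁ : l₁ = s₂₃ ++ u ++ m₁₂ ++ w ++ t₂₃ := by simp [f₁₂.left_eq]
  have e₂ : l₂ = s₂₃ ++ u ++ m₂₁ ++ w ++ t₂₃ := by simp [f₁₂.right_eq]
  have e₃ : l₃ = s₂₃ ++ m₃₂ ++ t₂₃ := f₁₃.right_eq
  have hst := hF.setAdj h₃ e₃ f₁₃.start_ne f₁₃.end_ne
  have c₁ := hF.chain _ h₁
  have c₂ := hF.chain _ h₂
  have c₃ := hF.chain _ h₃
  have n₁ := hF.nodup _ h₁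
  have n₂ := hF.nodup _ h₂
  have n₃ := hF.nodup _ h₃
  have p₁ := hF.nonSeparating _ h₁
  have p₂ := hF.nonSeparating _ h₂
  have p₃ := hF.nonSeparating _ h₃
  by_cases hw : w = []
  · by_cases hu : u = []
    · subst hw hu
      simp only [List.append_nil] at e₁ e₂
      rw [e₁] at c₁ n₁ p₁
      rw [e₂] at c₂ n₂ p₂
      rw [e₃] at c₃ n₃ p₃
      exact not_isPlanar_of_parallel c₁ c₂ c₃ n₁ n₂ n₃ f₁₂.disjoint
        (by simpa using f₁₃.disjoint) (by simpa using f₂₃.disjoint) f₁₃.start_ne f₁₃.end_ne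
        f₁₂.left_ne f₁₂.right_ne f₁₃.right_ne hst p₁ p₂ p₃
    · have r₁ : l₁.reverse = t₂₃.reverse ++ w.reverse ++ m₁₂.reverse ++ u.reverse ++
        s₂₃.reverse := by simp [e₁]
      have r₂ : l₂.reverse = t₂₃.reverse ++ w.reverse ++ m₂₁.reverse ++ u.reverse ++
        s₂₃.reverse := by simp [e₂]
      have r₃ : l₃.reverse = t₂₃.reverse ++ m₃₂.reverse ++ s₂₃.reverse := by simp [e₃]
      have rc : ∀ l : List V, l.IsChain G.Adj → l.reverse.IsChain G.Adj := fun l hl => by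
        rw [List.isChain_reverse]
        exact hl.imp fun a b hab => hab.symm
      have d₁ : (w.reverse ++ m₁₂.reverse ++ u.reverse).Disjoint m₃₂.reverse := by
        simpa using f₁₃.reverse.disjoint
      have d₂ : (w.reverse ++ m₂₁.reverse ++ u.reverse).Disjoint m₃₂.reverse := by
        simpa using f₂₃.reverse.disjoint
      refine SimpleGraph.not_isPlanar_of_nested (r₁ ▸ rc _ c₁) (r₂ ▸ rc _ c₂) (r₃ ▸ rc _ c₃)
        (r₁ ▸ List.nodup_reverse.2 n₁) (r₂ ▸ List.nodup_reverse.2 n₂)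
        (r₃ ▸ List.nodup_reverse.2 n₃) f₁₂.reverse.disjoint d₁ d₂
        (by simp [f₁₃.end_ne]) (by simp [f₁₃.start_ne]) (by simp [hu])
        (by simp [f₁₂.left_ne]) (by simp [f₁₂.right_ne]) (by simp [f₁₃.right_ne])
        (by simpa using hst.symm) (r₁ ▸ p₁.of_perm (by simp)) (r₂ ▸ p₂.of_perm (by simp))
  · rw [e₁] at c₁ n₁ p₁
    rw [e₂] at c₂ n₂ p₂
    rw [e₃] at c₃ n₃ p₃
    exact SimpleGraph.not_isPlanar_of_nested c₁ c₂ c₃ n₁ n₂ n₃ f₁₂.disjoint f₁₃.disjoint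
      f₂₃.disjoint f₁₃.start_ne f₁₃.end_ne hw f₁₂.left_ne f₁₂.right_ne f₁₃.right_ne hst p₁ p₂

lemma not_isPlanar_of_crossing [Finite V] (hF : G.IsPathFamily x y F) (h₁ : l₁ ∈ F) (h₂ : l₂ ∈ F)
    (h₃ : l₃ ∈ F) (f₁₂ : ListFork l₁ l₂ s₁₂ m₁₂ m₂₁ t₁₂) (f₁₃ : ListFork l₁ l₃ s₁₃ m₁₃ m₃₁ t₁₃)
    (f₂₃ : ListFork l₂ l₃ s₂₃ m₂₃ m₃₂ t₂₃)
    (hs : s₁₃.length < s₁₂.length) (hs' : s₂₃.length ≤ s₁₂.length)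
    (ht : t₁₂.length < t₁₃.length) (ht' : t₂₃.length ≤ t₁₃.length) : ¬ G.IsPlanar := by
  obtain ⟨rfl, u, rfl⟩ := f₁₂.start_eq_of_length_le f₁₃ f₂₃ hs.le hs'
  obtain ⟨rfl, w, rfl⟩ := f₁₃.end_eq_of_length_le f₁₂ f₂₃.symm ht.le ht'
  have hu : u ≠ [] := by rintro rfl; simp at hs
  have hw : w ≠ [] := by rintro rfl; simp at ht
  obtain rfl : m₂₃ = u ++ m₂₁ := by
    have := f₂₃.left_eq.symm.trans f₁₂.right_eq
    have := by simpa [← List.append_assoc] using this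
    simpa [List.append_assoc] using this
  obtain rfl : m₃₂ = m₃₁ ++ w := by
    have := f₂₃.right_eq.symm.trans f₁₃.right_eq
    have := by simpa [← List.append_assoc] using this
    simpa [List.append_assoc] using this
  obtain ⟨m₁, rfl, rfl⟩ : ∃ m₁, m₁₂ = m₁ ++ w ∧ m₁₃ = u ++ m₁ := by
    have e : u ++ m₁₂ = m₁₃ ++ w := by
      have := f₁₂.left_eq.symm.trans f₁₃.left_eq
      have := by simpa [← List.append_assoc] using this
      simpa [List.append_assoc] using this
    rcases List.append_eq_append_iff.1 e with ⟨c, h1, h2⟩ | ⟨c, h1, h2⟩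
    · exact ⟨c, h2, h1⟩
    · cases c with
      | nil => exact ⟨[], by simpa using h2.symm, by simpa using h1.symm⟩
      | cons a c =>
        exact (f₂₃.disjoint (a := a) (by simp [h1]) (by simp [h2])).elim
  have e₁ : l₁ = s₂₃ ++ u ++ m₁ ++ w ++ t₂₃ := by simp [f₁₂.left_eq]
  have e₂ : l₂ = s₂₃ ++ u ++ m₂₁ ++ t₂₃ := by simp [f₁₂.right_eq]
  have e₃ : l₃ = s₂₃ ++ m₃₁ ++ w ++ t₂₃ := by simp [f₁₃.right_eq]
  have hst := hF.setAdj h₂ f₂₃.left_eq f₂₃.start_ne f₂₃.end_ne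
  have c₁ := hF.chain _ h₁
  have c₂ := hF.chain _ h₂
  have c₃ := hF.chain _ h₃
  have n₁ := hF.nodup _ h₁
  have n₂ := hF.nodup _ h₂
  have n₃ := hF.nodup _ h₃
  have p₁ := hF.nonSeparating _ h₁
  rw [e₁] at c₁ n₁ p₁
  rw [e₂] at c₂ n₂
  rw [e₃] at c₃ n₃
  exact SimpleGraph.not_isPlanar_of_crossing c₁ c₂ c₃ n₁ n₂ n₃ f₁₂.disjoint f₁₃.disjoint
    f₂₃.disjoint f₂₃.start_ne f₂₃.end_ne hu hw f₁₂.right_ne f₁₃.right_ne hst p₁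

lemma not_isPlanar_of_start_le [Finite V] (hF : G.IsPathFamily x y F) (h₁ : l₁ ∈ F)
    (h₂ : l₂ ∈ F) (h₃ : l₃ ∈ F) (f₁₂ : ListFork l₁ l₂ s₁₂ m₁₂ m₂₁ t₁₂)
    (f₁₃ : ListFork l₁ l₃ s₁₃ m₁₃ m₃₁ t₁₃) (f₂₃ : ListFork l₂ l₃ s₂₃ m₂₃ m₃₂ t₂₃)
    (hs : s₁₃.length ≤ s₁₂.length) (hs' : s₂₃.length ≤ s₁₂.length) : ¬ G.IsPlanar := by
  obtain ⟨e, -⟩ := f₁₂.start_eq_of_length_le f₁₃ f₂₃ hs hs'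
  by_cases h12 : t₁₃.length ≤ t₁₂.length ∧ t₂₃.length ≤ t₁₂.length
  · exact hF.not_isPlanar_of_nested h₁ h₂ h₃ f₁₂ f₁₃ f₂₃ hs hs' h12.1 h12.2
  by_cases h13 : t₂₃.length ≤ t₁₃.length
  · rcases hs.lt_or_eq with hs1 | hs1
    · exact hF.not_isPlanar_of_crossing h₁ h₂ h₃ f₁₂ f₁₃ f₂₃ hs1 hs' (by omega) h13
    · exact hF.not_isPlanar_of_nested h₁ h₃ h₂ f₁₃ f₁₂ f₂₃.symm hs1.ge (by omega) (by omega) h13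
  · rcases hs.lt_or_eq with hs1 | hs1
    · exact hF.not_isPlanar_of_crossing h₂ h₁ h₃ f₁₂.symm f₂₃ f₁₃ (by rwa [e]) hs (by omega)
        (by omega)
    · exact hF.not_isPlanar_of_nested h₂ h₃ h₁ f₂₃ f₁₂.symm f₁₃.symm (by rw [e, hs1])
        (by rw [e]) (by omega) (by omega)

/-- A planar graph has no three such paths. -/
lemma not_isPlanar [Finite V] (hF : G.IsPathFamily x y F) (h₁ : l₁ ∈ F) (h₂ : l₂ ∈ F)
    (h₃ : l₃ ∈ F) (n₁₂ : l₁ ≠ l₂) (n₁₃ : l₁ ≠ l₃) (n₂₃ : l₂ ≠ l₃) : ¬ G.IsPlanar := by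
  have fork : ∀ l ∈ F, ∀ l' ∈ F, l ≠ l' → ∃ s m m' t, ListFork l l' s m m' t :=
    fun l hl l' hl' hne => exists_listFork hne (hF.nodup l hl) (hF.nodup l' hl')
      (hF.start_eq l hl) (hF.start_eq l' hl') (hF.end_eq l hl) (hF.end_eq l' hl')
      (hF.meet l hl l' hl') (hF.middle l hl l' hl') (hF.middle l' hl' l hl)
  obtain ⟨s₁₂, m₁₂, m₂₁, t₁₂, f₁₂⟩ := fork _ h₁ _ h₂ n₁₂
  obtain ⟨s₁₃, m₁₃, m₃₁, t₁₃, f₁₃⟩ := fork _ h₁ _ h₃ n₁₃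
  obtain ⟨s₂₃, m₂₃, m₃₂, t₂₃, f₂₃⟩ := fork _ h₂ _ h₃ n₂₃
  by_cases h12 : s₁₃.length ≤ s₁₂.length ∧ s₂₃.length ≤ s₁₂.length
  · exact hF.not_isPlanar_of_start_le h₁ h₂ h₃ f₁₂ f₁₃ f₂₃ h12.1 h12.2
  by_cases h13 : s₂₃.length ≤ s₁₃.length
  · exact hF.not_isPlanar_of_start_le h₁ h₃ h₂ f₁₃ f₁₂ f₂₃.symm (by omega) h13
  · exact hF.not_isPlanar_of_start_le h₂ h₃ h₁ f₂₃ f₁₂.symm f₁₃.symm (by omega) (by omega)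

end IsPathFamily

end ThreePaths

end SimpleGraph

open Finset in
/-- A fractional covering can be replaced by one of no larger weight whose support is no larger
than the set of tight constraints. -/
lemma exists_card_support_le_card_tight {ι : Type*} [Fintype ι] [DecidableEq ι]
    (𝒞 : Finset (Finset ι)) (ℓ : ι → ℝ) (h0 : ∀ e, 0 ≤ ℓ e) (hf : ∀ C ∈ 𝒞, 1 ≤ ∑ e ∈ C, ℓ e) :
    ∃ ℓ' : ι → ℝ, (∀ e, 0 ≤ ℓ' e) ∧ (∀ C ∈ 𝒞, 1 ≤ ∑ e ∈ C, ℓ' e) ∧ ∑ e, ℓ' e ≤ ∑ e, ℓ e ∧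
      #{e | ℓ' e ≠ 0} ≤ #{C ∈ 𝒞 | ∑ e ∈ C, ℓ' e = 1} := by
  induction hn : #{e | ℓ e ≠ 0} + #{C ∈ 𝒞 | ∑ e ∈ C, ℓ e ≠ 1} using Nat.strong_induction_on
    generalizing ℓ with
  | _ n ih =>
  subst hn
  by_cases hle : #{e | ℓ e ≠ 0} ≤ #{C ∈ 𝒞 | ∑ e ∈ C, ℓ e = 1}
  · exact ⟨ℓ, h0, hf, le_rfl, hle⟩
  push Not at hle
  obtain ⟨δ, hδ0, hδs, hδt⟩ : ∃ δ : ι → ℝ, δ ≠ 0 ∧ (∀ e, ℓ e = 0 → δ e = 0) ∧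
      ∀ C ∈ 𝒞, ∑ e ∈ C, ℓ e = 1 → ∑ e ∈ C, δ e = 0 := by
    let P : Finset ι := {e | ℓ e ≠ 0}
    let T : Finset (Finset ι) := {C ∈ 𝒞 | ∑ e ∈ C, ℓ e = 1}
    let ext : (P → ℝ) →ₗ[ℝ] (ι → ℝ) := Function.ExtendByZero.linearMap ℝ Subtype.val
    let f : (P → ℝ) →ₗ[ℝ] (T → ℝ) :=
      LinearMap.pi fun C => (∑ e ∈ C.1, LinearMap.proj e) ∘ₗ ext
    have hk : f.ker ≠ ⊥ := LinearMap.ker_ne_bot_of_finrank_lt (by simpa using hle)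
    obtain ⟨d, hd, hd0⟩ := Submodule.exists_mem_ne_zero_of_ne_bot hk
    refine ⟨ext d, ?_, ?_, ?_⟩
    · intro h
      apply hd0
      ext e
      have := congrFun h e.1
      simpa [ext, Subtype.val_injective.extend_apply] using this
    · intro e he
      have : ¬ ∃ a : P, a.1 = e := by rintro ⟨a, rfl⟩; exact (mem_filter.1 a.2).2 he
      simp [ext, Function.extend_apply' _ _ _ this]
    · intro C hC hC1
      have := congrFun (LinearMap.mem_ker.1 hd) ⟨C, by simp [T, hC, hC1]⟩
      simpa [f] using this
  wlog hδ : ∑ e, δ e ≤ 0 generalizing δ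
  · refine this (-δ) (by simpa using hδ0) (fun e he => by simp [hδs e he])
      (fun C hC h1 => by simp [hδt C hC h1]) ?_
    simp only [Pi.neg_apply, sum_neg_distrib]
    linarith
  obtain ⟨e₀, he₀⟩ : ∃ e, δ e < 0 := by
    by_contra! h
    apply hδ0
    have := (sum_eq_zero_iff_of_nonneg fun e _ => h e).1
      (le_antisymm hδ (sum_nonneg fun e _ => h e))
    ext e
    exact this e (mem_univ e)
  let R : Finset ℝ := ({e | δ e < 0} : Finset ι).image (fun e => ℓ e / (-δ e)) ∪
    ({C ∈ 𝒞 | ∑ e ∈ C, δ e < 0}).image (fun C => (∑ e ∈ C, ℓ e - 1) / (-∑ e ∈ C, δ e))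
  have hR : R.Nonempty := ⟨ℓ e₀ / (-δ e₀), by
    simp only [R, mem_union, mem_image, mem_filter, mem_univ, true_and]
    exact Or.inl ⟨e₀, he₀, rfl⟩⟩
  obtain ⟨t, htR, htmin⟩ := R.exists_min_image id hR
  simp only [id] at htmin
  have ht1 : ∀ e, δ e < 0 → t * (-δ e) ≤ ℓ e := fun e he =>
    (le_div_iff₀ (by linarith)).1 (htmin _ (by
      simp only [R, mem_union, mem_image, mem_filter, mem_univ, true_and]
      exact Or.inl ⟨e, he, rfl⟩))
  have ht2 : ∀ C ∈ 𝒞, ∑ e ∈ C, δ e < 0 → t * (-∑ e ∈ C, δ e) ≤ ∑ e ∈ C, ℓ e - 1 := fun C hC he =>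
    (le_div_iff₀ (by linarith)).1 (htmin _ (by
      simp only [R, mem_union, mem_image, mem_filter]
      exact Or.inr ⟨C, ⟨hC, he⟩, rfl⟩))
  have ht0 : 0 ≤ t := by
    simp only [R, mem_union, mem_image, mem_filter, mem_univ, true_and] at htR
    rcases htR with ⟨e, he, rfl⟩ | ⟨C, ⟨hC, he⟩, rfl⟩
    · exact div_nonneg (h0 e) (by linarith)
    · exact div_nonneg (by linarith [hf C hC]) (by linarith)
  have hsum : ∀ C : Finset ι, ∑ e ∈ C, (ℓ e + t * δ e) = ∑ e ∈ C, ℓ e + t * ∑ e ∈ C, δ e :=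
    fun C => by rw [sum_add_distrib, mul_sum]
  have hsub1 : ({e | ℓ e + t * δ e ≠ 0} : Finset ι) ⊆ ({e | ℓ e ≠ 0} : Finset ι) := by
    intro e
    simp only [mem_filter, mem_univ, true_and]
    intro h h'
    simp [h', hδs e h'] at h
  have hsub2 : ({C ∈ 𝒞 | ∑ e ∈ C, (ℓ e + t * δ e) ≠ 1}) ⊆ {C ∈ 𝒞 | ∑ e ∈ C, ℓ e ≠ 1} := by
    intro C
    simp only [mem_filter, hsum]
    rintro ⟨hC, h⟩
    refine ⟨hC, fun h' => ?_⟩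
    simp [h', hδt C hC h'] at h
  have hlt : #{e | ℓ e + t * δ e ≠ 0} + #{C ∈ 𝒞 | ∑ e ∈ C, (ℓ e + t * δ e) ≠ 1} <
      #{e | ℓ e ≠ 0} + #{C ∈ 𝒞 | ∑ e ∈ C, ℓ e ≠ 1} := by
    simp only [R, mem_union, mem_image, mem_filter, mem_univ, true_and] at htR
    rcases htR with ⟨e, he, ht⟩ | ⟨C, ⟨hC, he⟩, ht⟩
    · refine add_lt_add_of_lt_of_le (card_lt_card ⟨hsub1, fun h => ?_⟩) (card_le_card hsub2)
      have h1 : ℓ e ≠ 0 := fun h' => he.ne (hδs e h')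
      have h2 := h (show e ∈ _ by simpa using h1)
      simp only [mem_filter, mem_univ, true_and] at h2
      apply h2
      have := he.ne
      rw [← ht]
      field_simp
      ring
    · refine add_lt_add_of_le_of_lt (card_le_card hsub1) (card_lt_card ⟨hsub2, fun h => ?_⟩)
      have h1 : ∑ e ∈ C, ℓ e ≠ 1 := fun h' => he.ne (hδt C hC h')
      have h2 := h (show C ∈ _ by simpa [hC] using h1)
      simp only [mem_filter, hsum] at h2
      apply h2.2
      have := he.ne
      rw [← ht]
      field_simp
      ring
  have hnn : ∀ e, 0 ≤ ℓ e + t * δ e := by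
    intro e
    by_cases he : δ e < 0
    · linarith [ht1 e he]
    · have := mul_nonneg ht0 (not_lt.1 he)
      linarith [h0 e]
  have hfeas : ∀ C ∈ 𝒞, 1 ≤ ∑ e ∈ C, (ℓ e + t * δ e) := by
    intro C hC
    rw [hsum]
    by_cases he : ∑ e ∈ C, δ e < 0
    · linarith [ht2 C hC he]
    · have := mul_nonneg ht0 (not_lt.1 he)
      linarith [hf C hC]
  obtain ⟨ℓ', a1, a2, a3, a4⟩ := ih _ hlt (fun e => ℓ e + t * δ e) hnn hfeas rfl
  refine ⟨ℓ', a1, a2, a3.trans ?_, a4⟩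
  rw [hsum]
  nlinarith

namespace SimpleGraph

section Weight

variable {V : Type*} {G : SimpleGraph V}

namespace Walk

variable {u v w : V}

lemma exists_eq_append_of_support_eq (p : G.Walk u v) {P Q : List V} {z : V}
    (h : p.support = P ++ z :: Q) :
    ∃ (q₁ : G.Walk u z) (q₂ : G.Walk z v), p = q₁.append q₂ ∧ q₁.support = P ++ [z] ∧
      q₂.support = z :: Q := by
  induction p generalizing P with
  | nil =>
    cases P with
    | nil =>
      simp only [support_nil, List.nil_append, List.cons.injEq] at h
      obtain ⟨rfl, rfl⟩ := h
      exact ⟨nil, nil, rfl, rfl, rfl⟩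
    | cons a P => simp at h
  | @cons a b c hab p ih =>
    cases P with
    | nil =>
      simp only [support_cons, List.nil_append, List.cons.injEq] at h
      obtain ⟨rfl, rfl⟩ := h
      exact ⟨nil, cons hab p, rfl, rfl, rfl⟩
    | cons a' P =>
      simp only [support_cons, List.cons_append, List.cons.injEq] at h
      obtain ⟨rfl, h⟩ := h
      obtain ⟨q₁, q₂, rfl, h₁, h₂⟩ := ih h
      exact ⟨cons hab q₁, q₂, rfl, by simp [h₁], h₂⟩

/-- The total weight of the edges of a walk. -/
def weight (ℓ : Sym2 V → ℝ) (p : G.Walk u v) : ℝ := (p.edges.map ℓ).sum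

variable {ℓ : Sym2 V → ℝ}

@[simp] lemma weight_cons (h : G.Adj u v) (p : G.Walk v w) :
    (cons h p).weight ℓ = ℓ s(u, v) + p.weight ℓ := by simp [weight]

@[simp] lemma weight_append (p : G.Walk u v) (q : G.Walk v w) :
    (p.append q).weight ℓ = p.weight ℓ + q.weight ℓ := by simp [weight]

lemma IsTrail.weight_eq_sum {p : G.Walk u v} (hp : p.IsTrail) {C : Finset (Sym2 V)}
    (hC : ∀ e, e ∈ C ↔ e ∈ p.edges) : p.weight ℓ = ∑ e ∈ C, ℓ e := by
  classical
  rw [weight, ← List.sum_toFinset _ hp.edges_nodup]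
  congr 1
  ext e
  simp [hC]

lemma weight_of_support_eq_pair {a b : V} {p : G.Walk u v} (h : p.support = [a, b]) :
    p.weight ℓ = ℓ s(a, b) := by
  cases p with
  | nil => simp at h
  | cons hab p =>
    cases p with
    | nil =>
      simp only [support_cons, support_nil, List.cons.injEq, and_true] at h
      simp [weight, h.1, h.2]
    | cons hab' p => simp at h

end Walk

/-- Every cycle has weight at least one. -/
def CycleWeightGeOne (G : SimpleGraph V) (ℓ : Sym2 V → ℝ) : Prop :=
  ∀ (v : V) (c : G.Walk v v), c.IsCycle → 1 ≤ c.weight ℓ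

lemma CycleWeightGeOne.mono {H : SimpleGraph V} {ℓ : Sym2 V → ℝ} (h : G.CycleWeightGeOne ℓ)
    (hH : H ≤ G) : H.CycleWeightGeOne ℓ := by
  intro v c hc
  have := h v (c.mapLe hH) (hc.mapLe hH)
  simpa [Walk.weight] using this

lemma CycleWeightGeOne.one_le_weight_add_weight {ℓ : Sym2 V → ℝ} (h : G.CycleWeightGeOne ℓ)
    (h0 : ∀ e, 0 ≤ ℓ e) {u v : V} {p q : G.Walk u v} (hp : p.IsPath) (hq : q.IsPath)
    (hne : p ≠ q) : 1 ≤ p.weight ℓ + q.weight ℓ := by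
  classical
  let H : SimpleGraph V := fromEdgeSet {e | e ∈ p.edges ∨ e ∈ q.edges}
  have hmem : ∀ e, e ∈ H.edgeSet ↔ e ∈ p.edges ∨ e ∈ q.edges := by
    intro e
    simp only [H, edgeSet_fromEdgeSet, Set.mem_sdiff, Set.mem_ofPred_eq, and_iff_left_iff_imp]
    rintro (he | he) hd
    · exact G.not_isDiag_of_mem_edgeSet (p.edges_subset_edgeSet he) hd
    · exact G.not_isDiag_of_mem_edgeSet (q.edges_subset_edgeSet he) hd
  have hac : ¬ H.IsAcyclic := by
    intro hac
    have hp' := fun e he => (hmem e).2 (Or.inl he)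
    have hq' := fun e he => (hmem e).2 (Or.inr he)
    have := (hac.subsingleton_path u v).elim ⟨p.transfer H hp', hp.transfer hp'⟩
      ⟨q.transfer H hq', hq.transfer hq'⟩
    apply hne
    apply Walk.ext_support
    have := congrArg (fun r : H.Path u v => r.1.support) this
    simpa using this
  simp only [IsAcyclic] at hac
  push Not at hac
  obtain ⟨w, c, hc⟩ := hac
  have hle : H ≤ G := by
    rw [← edgeSet_subset_edgeSet]
    intro e he
    rcases (hmem e).1 he with h | h
    · exact p.edges_subset_edgeSet h
    · exact q.edges_subset_edgeSet h
  have h1 := h.mono hle w c hc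
  rw [hc.isTrail.weight_eq_sum (C := c.edges.toFinset) (by simp)] at h1
  rw [hp.isTrail.weight_eq_sum (C := p.edges.toFinset) (by simp),
    hq.isTrail.weight_eq_sum (C := q.edges.toFinset) (by simp), ← Finset.sum_union_inter]
  have h2 : ∑ e ∈ c.edges.toFinset, ℓ e ≤ ∑ e ∈ p.edges.toFinset ∪ q.edges.toFinset, ℓ e := by
    refine Finset.sum_le_sum_of_subset_of_nonneg ?_ fun e _ _ => h0 e
    intro e he
    simpa using (hmem e).1 (c.edges_subset_edgeSet (by simpa using he))
  have h3 : 0 ≤ ∑ e ∈ p.edges.toFinset ∩ q.edges.toFinset, ℓ e := Finset.sum_nonneg fun e _ => h0 e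
  linarith

lemma Walk.IsCycle.exists_isPath_of_mem_edges {v x y : V} {c : G.Walk v v} (hc : c.IsCycle)
    (he : s(x, y) ∈ c.edges) : ∃ p : G.Walk x y, p.IsPath ∧ s(x, y) ∉ p.edges ∧
      ∀ e, e ∈ c.edges ↔ e = s(x, y) ∨ e ∈ p.edges := by
  classical
  have hx := c.fst_mem_support_of_mem_edges he
  have hc' := hc.rotate hx
  have hmem : ∀ e, e ∈ (c.rotate x hx).edges ↔ e ∈ c.edges := fun e => (c.rotate_edges x hx).mem_iff
  simp only [← hmem] at he ⊢
  generalize c.rotate x hx = c' at *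
  cases c' with
  | nil => simp at he
  | @cons _ z _ h q =>
    obtain ⟨hq, hxz⟩ := Walk.cons_isCycle_iff _ _ |>.1 hc'
    by_cases hyz : y = z
    · subst hyz
      exact ⟨q.reverse, hq.reverse, by simpa using hxz, by simp⟩
    · have he' : s(x, y) ∈ q.reverse.edges := by
        simp only [Walk.edges_cons, List.mem_cons] at he
        rcases he with he | he
        · simp only [Sym2.eq_iff, true_and] at he
          rcases he with he | ⟨he, -⟩
          · exact absurd he hyz
          · exact absurd he h.ne
        · simpa using he
      have hq' := hq.reverse
      have hed : ∀ e, e ∈ q.edges ↔ e ∈ q.reverse.edges := by simp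
      simp only [Walk.edges_cons, List.mem_cons, hed] at hxz ⊢
      generalize q.reverse = q' at *
      cases q' with
      | nil => simp at he'
      | @cons _ y' _ h' r =>
        obtain ⟨hr, hxr⟩ := Walk.cons_isPath_iff _ _ |>.1 hq'
        obtain rfl : y = y' := by
          simp only [Walk.edges_cons, List.mem_cons] at he'
          rcases he' with he' | he'
          · simp only [Sym2.eq_iff, true_and] at he'
            rcases he' with he' | ⟨he', -⟩
            · exact he'
            · exact absurd he' h'.ne
          · exact absurd (r.fst_mem_support_of_mem_edges he') hxr
        refine ⟨Walk.cons h r.reverse, ?_, ?_, ?_⟩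
        · simpa [Walk.cons_isPath_iff, hr] using hxr
        · simp only [Walk.edges_cons, Walk.edges_reverse, List.mem_cons, List.mem_reverse, not_or]
          refine ⟨?_, fun h1 => hxr (r.fst_mem_support_of_mem_edges h1)⟩
          simp only [Sym2.eq_iff, true_and, not_or]
          exact ⟨hyz, fun h1 => h.ne h1.1⟩
        · intro e
          simp only [Walk.edges_cons, Walk.edges_reverse, List.mem_cons, List.mem_reverse]
          tauto

end Weight

end SimpleGraph

namespace SimpleGraph

section TightPaths

variable {V : Type*} {G : SimpleGraph V} {ℓ : Sym2 V → ℝ} {x y : V}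

/-- The supports of the paths which form a cycle of weight one together with the edge `xy`. -/
def tightPaths (G : SimpleGraph V) (ℓ : Sym2 V → ℝ) (x y : V) : Set (List V) :=
  {l | ∃ p : G.Walk x y, p.IsPath ∧ s(x, y) ∉ p.edges ∧ ℓ s(x, y) + p.weight ℓ = 1 ∧ p.support = l}

lemma isPathFamily_tightPaths (hxy : G.Adj x y) (h : G.CycleWeightGeOne ℓ) (h0 : ∀ e, 0 ≤ ℓ e)
    (hpos : 0 < ℓ s(x, y)) (hhalf : ∀ e ∈ G.edgeSet, ℓ e < 1 / 2)
    (hns : ∀ (v : V) (c : G.Walk v v), c.IsCycle → c.weight ℓ = 1 → G.NonSeparating c.support) :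
    G.IsPathFamily x y (G.tightPaths ℓ x y) where
  adj := hxy
  chain := by
    rintro _ ⟨p, -, -, -, rfl⟩
    exact p.isChain_adj_support
  nodup := by
    rintro _ ⟨p, hp, -, -, rfl⟩
    exact hp.support_nodup
  start_eq := by
    rintro _ ⟨p, -, -, -, rfl⟩
    exact ⟨_, p.cons_tail_support.symm⟩
  end_eq := by
    rintro _ ⟨p, -, -, -, rfl⟩
    exact ⟨_, p.dropLast_support_concat.symm⟩
  nonSeparating := by
    rintro _ ⟨p, hp, hxp, hw, rfl⟩
    have hc : (Walk.cons hxy.symm p).IsCycle :=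
      (Walk.cons_isCycle_iff _ _).2 ⟨hp, by rwa [Sym2.eq_swap]⟩
    refine (hns y _ hc (by rw [Walk.weight_cons, Sym2.eq_swap, hw])).of_perm fun v => ?_
    simp only [Walk.support_cons, List.mem_cons, or_iff_right_iff_imp]
    rintro rfl
    simp
  meet := by
    rintro _ ⟨p, hp, -, hw, rfl⟩ _ ⟨p', hp', -, hw', rfl⟩ z P Q P' Q' e e'
    obtain ⟨q₁, q₂, rfl, hq₁, hq₂⟩ := p.exists_eq_append_of_support_eq e
    obtain ⟨q₁', q₂', rfl, hq₁', hq₂'⟩ := p'.exists_eq_append_of_support_eq e'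
    by_contra! hne
    have n₁ : q₁ ≠ q₁' := by
      rintro rfl
      exact hne.1 (by simpa using hq₁.symm.trans hq₁')
    have n₂ : q₂ ≠ q₂' := by
      rintro rfl
      exact hne.2 (by simpa using hq₂.symm.trans hq₂')
    have w₁ := h.one_le_weight_add_weight h0 hp.of_append_left hp'.of_append_left n₁
    have w₂ := h.one_le_weight_add_weight h0 hp.of_append_right hp'.of_append_right n₂
    rw [Walk.weight_append] at hw hw'
    linarith
  middle := by
    rintro _ ⟨p, hp, -, hw, rfl⟩ _ ⟨p', hp', -, hw', rfl⟩ S M T hS hT e e'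
    rcases List.eq_nil_or_concat' S with rfl | ⟨S, a, rfl⟩
    · exact absurd rfl hS
    cases T with
    | nil => exact absurd rfl hT
    | cons b T =>
    by_contra hM
    have e₁ : p.support = S ++ a :: (b :: T) := by simpa using e
    have e₁' : p'.support = S ++ a :: (M ++ b :: T) := by simpa using e'
    obtain ⟨q₁, q₂, rfl, hq₁, hq₂⟩ := p.exists_eq_append_of_support_eq e₁
    obtain ⟨q₁', q₂', rfl, hq₁', hq₂'⟩ := p'.exists_eq_append_of_support_eq e₁'
    obtain rfl : q₁ = q₁' := Walk.ext_support (by rw [hq₁, hq₁'])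
    obtain ⟨r₁, r₂, rfl, hr₁, hr₂⟩ := q₂.exists_eq_append_of_support_eq (P := [a]) hq₂
    obtain ⟨r₁', r₂', rfl, hr₁', hr₂'⟩ := q₂'.exists_eq_append_of_support_eq (P := a :: M) hq₂'
    obtain rfl : r₂ = r₂' := Walk.ext_support (by rw [hr₂, hr₂'])
    have n₁ : r₁ ≠ r₁' := by
      rintro rfl
      apply hM
      simpa using (hr₁.symm.trans hr₁').symm
    have w₁ := h.one_le_weight_add_weight h0 hp.of_append_right.of_append_left
      hp'.of_append_right.of_append_left n₁
    simp only [Walk.weight_append] at hw hw'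
    have w₂ := Walk.weight_of_support_eq_pair (ℓ := ℓ) (p := r₁) (by simpa using hr₁)
    have hab : G.Adj a b := by
      have := r₁.isChain_adj_support
      rw [hr₁] at this
      simpa using this
    have := hhalf s(a, b) hab
    linarith

/-- `C` is the edge set of a cycle of weight one. -/
def IsTightCycle (G : SimpleGraph V) (ℓ : Sym2 V → ℝ) (C : Finset (Sym2 V)) : Prop :=
  ∃ (v : V) (c : G.Walk v v), c.IsCycle ∧ (∀ e, e ∈ C ↔ e ∈ c.edges) ∧ c.weight ℓ = 1

lemma IsTightCycle.exists_mem_tightPaths {C : Finset (Sym2 V)} (hC : G.IsTightCycle ℓ C)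
    (he : s(x, y) ∈ C) : ∃ l ∈ G.tightPaths ℓ x y, ∀ e, e ∈ C ↔ e = s(x, y) ∨
      ∃ p : G.Walk x y, p.support = l ∧ e ∈ p.edges := by
  classical
  obtain ⟨v, c, hc, hC, hw⟩ := hC
  obtain ⟨p, hp, hxp, h⟩ := hc.exists_isPath_of_mem_edges ((hC _).1 he)
  refine ⟨p.support, ⟨p, hp, hxp, ?_, rfl⟩, fun e => ?_⟩
  · rw [← hw, hc.isTrail.weight_eq_sum hC,
      hp.isTrail.weight_eq_sum (C := p.edges.toFinset) (by simp),
      ← Finset.sum_insert (by simpa using hxp)]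
    congr 1
    ext e
    simp [hC, h]
  · rw [hC, h]
    refine or_congr_right ⟨fun h => ⟨p, rfl, h⟩, ?_⟩
    rintro ⟨q, hq, heq⟩
    rwa [Walk.ext_support hq] at heq

/-- In a planar graph an edge of positive weight lies on at most two cycles of weight one. -/
lemma IsPlanar.card_tightCycles_le_two [Finite V] (hG : G.IsPlanar) (h : G.CycleWeightGeOne ℓ)
    (h0 : ∀ e, 0 ≤ ℓ e) (hhalf : ∀ e ∈ G.edgeSet, ℓ e < 1 / 2)
    (hns : ∀ (v : V) (c : G.Walk v v), c.IsCycle → c.weight ℓ = 1 → G.NonSeparating c.support)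
    {e : Sym2 V} (hpos : 0 < ℓ e) {𝒯 : Finset (Finset (Sym2 V))}
    (h𝒯 : ∀ C ∈ 𝒯, G.IsTightCycle ℓ C ∧ e ∈ C) : 𝒯.card ≤ 2 := by
  by_contra! hcard
  obtain ⟨C₁, C₂, C₃, h₁, h₂, h₃, n₁₂, n₁₃, n₂₃⟩ := Finset.two_lt_card_iff.1 hcard
  induction e using Sym2.ind with
  | _ x y =>
  have hxy : G.Adj x y := by
    obtain ⟨⟨v, c, -, hC, -⟩, he⟩ := h𝒯 _ h₁
    exact c.adj_of_mem_edges ((hC _).1 he)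
  obtain ⟨l₁, hl₁, e₁⟩ := (h𝒯 _ h₁).1.exists_mem_tightPaths (h𝒯 _ h₁).2
  obtain ⟨l₂, hl₂, e₂⟩ := (h𝒯 _ h₂).1.exists_mem_tightPaths (h𝒯 _ h₂).2
  obtain ⟨l₃, hl₃, e₃⟩ := (h𝒯 _ h₃).1.exists_mem_tightPaths (h𝒯 _ h₃).2
  refine (isPathFamily_tightPaths hxy h h0 hpos hhalf hns).not_isPlanar hl₁ hl₂ hl₃ ?_ ?_ ?_ hG
  · rintro rfl
    exact n₁₂ (Finset.ext fun e => by rw [e₁, e₂])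
  · rintro rfl
    exact n₁₃ (Finset.ext fun e => by rw [e₁, e₃])
  · rintro rfl
    exact n₂₃ (Finset.ext fun e => by rw [e₂, e₃])

end TightPaths

end SimpleGraph

namespace SimpleGraph

section EulerBound

variable {V : Type*} {G : SimpleGraph V} {ℓ : Sym2 V → ℝ}

lemma Walk.IsCycle.ncard_support_le {v : V} {c : G.Walk v v} (hc : c.IsCycle)
    {C : Finset (Sym2 V)} (hC : ∀ e, e ∈ C ↔ e ∈ c.edges) :
    {w | w ∈ c.support}.ncard ≤ C.card := by
  classical
  have h1 : C = c.edges.toFinset := by ext; simp [hC]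
  have h2 : {w | w ∈ c.support} = (c.support.tail.toFinset : Set V) := by
    ext w
    simp only [Set.mem_ofPred_eq, Finset.mem_coe, List.mem_toFinset]
    refine ⟨fun h => ?_, List.mem_of_mem_tail⟩
    rw [← c.cons_tail_support, List.mem_cons] at h
    rcases h with rfl | h
    · exact c.end_mem_tail_support hc.not_nil
    · exact h
  rw [h1, h2, Set.ncard_coe_finset, List.toFinset_card_of_nodup hc.edges_nodup]
  refine (List.toFinset_card_le _).trans ?_
  simp

variable [Finite V]

lemma IsAcyclic.ncard_edgeSet_lt (hG : G.IsAcyclic) (hne : G.edgeSet.Nonempty) :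
    G.edgeSet.ncard < G.support.ncard := by
  classical
  cases nonempty_fintype V
  obtain ⟨e, he⟩ := hne
  have : Nonempty G.support := by
    induction e using Sym2.ind with
    | _ x y => exact ⟨x, y, he⟩
  obtain ⟨T, hT, -, hT'⟩ := (connected_top (V := G.support)).exists_isTree_le_of_le_of_isAcyclic
    le_top (hG.induce G.support)
  have h1 := hT'.card_edgeFinset
  have h2 := Finset.card_le_card (edgeFinset_subset_edgeFinset.2 hT)
  rw [card_edgeFinset_induce_support] at h2
  rw [Set.ncard_eq_toFinset_card' G.support, Set.ncard_eq_toFinset_card' G.edgeSet,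
    Set.toFinset_card G.support]
  have h3 : G.edgeSet.toFinset = G.edgeFinset := by ext; simp
  rw [h3]
  omega

/-- The lower bound on the total weight of the edges that follows from Euler's formula. -/
def EulerBound (G : SimpleGraph V) (ℓ : Sym2 V → ℝ) : Prop :=
  (G.edgeSet.ncard : ℝ) - G.support.ncard + 2 ≤ 2 * ∑ e ∈ G.edgeSet.toFinite.toFinset, ℓ e

/-- A graph in which a cycle of weight one separates satisfies the bound if all smaller graphs
do. -/
lemma eulerBound_of_not_nonSeparating
    (ih : ∀ H : SimpleGraph V, H ≤ G → H.edgeSet.ncard < G.edgeSet.ncard → ¬ H.IsAcyclic →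
      H.EulerBound ℓ) {v : V} {c : G.Walk v v} (hc : c.IsCycle) (hw : c.weight ℓ = 1)
    (hsep : ¬ G.NonSeparating c.support) : G.EulerBound ℓ := by
  classical
  simp only [NonSeparating] at hsep
  push Not at hsep
  obtain ⟨B, ⟨b, hb, hbs⟩, hBc, ⟨d, hds, hdB, hdc⟩, hadj⟩ := hsep
  let E := G.edgeSet.toFinite.toFinset
  let C := c.edges.toFinset
  have hCmem : ∀ e, e ∈ C ↔ e ∈ c.edges := by simp [C]
  have hCE : C ⊆ E := fun e he => by
    simpa [E] using c.edges_subset_edgeSet ((hCmem e).1 he)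
  have hCB : ∀ e ∈ C, ¬ ∃ b ∈ B, b ∈ e := by
    rintro e he ⟨b, hb, hbe⟩
    exact hBc b hb (c.mem_support_of_mem_edges ((hCmem e).1 he) hbe)
  have hedge : ∀ F : Finset (Sym2 V), F ⊆ E →
      (fromEdgeSet (F : Set (Sym2 V))).edgeSet = F := by
    intro F hF
    rw [edgeSet_fromEdgeSet, sdiff_eq_left, Set.disjoint_left]
    intro e he hd
    exact G.not_isDiag_of_mem_edgeSet (by simpa [E] using hF he) hd
  let E₁ := E.filter (fun e => ∃ b ∈ B, b ∈ e) ∪ C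
  let E₂ := E.filter (fun e => ¬ ∃ b ∈ B, b ∈ e)
  have hE₁ : E₁ ⊆ E := Finset.union_subset (Finset.filter_subset _ _) hCE
  have hE₂ : E₂ ⊆ E := Finset.filter_subset _ _
  have hCE₁ : C ⊆ E₁ := Finset.subset_union_right
  have hCE₂ : C ⊆ E₂ := fun e he => Finset.mem_filter.2 ⟨hCE he, hCB e he⟩
  have hdisj : Disjoint (E.filter (fun e => ∃ b ∈ B, b ∈ e)) C := by
    rw [Finset.disjoint_right]
    exact fun e he he' => hCB e he (Finset.mem_filter.1 he').2
  have hsub : ∀ F : Finset (Sym2 V), F ⊆ E → C ⊆ F → F ≠ E →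
      (F.card : ℝ) - (fromEdgeSet (F : Set (Sym2 V))).support.ncard + 2 ≤ 2 * ∑ e ∈ F, ℓ e := by
    intro F hF hCF hne
    have hmem : ∀ e ∈ c.edges, e ∈ (fromEdgeSet (F : Set (Sym2 V))).edgeSet := by
      intro e he
      rw [hedge F hF]
      exact hCF ((hCmem e).2 he)
    have := ih (fromEdgeSet F) ?_ ?_ fun hac => hac _ (hc.transfer hmem)
    · have h' : (fromEdgeSet (F : Set (Sym2 V))).edgeSet.toFinite.toFinset = F := by
        ext e
        rw [Set.Finite.mem_toFinset, hedge F hF, Finset.mem_coe]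
      rwa [EulerBound, h', hedge F hF, Set.ncard_coe_finset] at this
    · rw [← edgeSet_subset_edgeSet, hedge F hF]
      intro e he
      simpa [E] using hF he
    · rw [hedge F hF, Set.ncard_coe_finset, Set.ncard_eq_toFinset_card _ G.edgeSet.toFinite]
      exact Finset.card_lt_card (hF.ssubset_of_ne hne)
  have b₁ := hsub E₁ hE₁ hCE₁ ?_
  · have b₂ := hsub E₂ hE₂ hCE₂ ?_
    · have hcard : (E₁.card : ℝ) + E₂.card = G.edgeSet.ncard + C.card := by
        rw [Finset.card_union_of_disjoint hdisj, Set.ncard_eq_toFinset_card _ G.edgeSet.toFinite,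
          ← Finset.card_filter_add_card_filter_not (s := G.edgeSet.toFinite.toFinset)
            (fun e => ∃ b ∈ B, b ∈ e)]
        push_cast
        ring
      have hsum : ∑ e ∈ E₁, ℓ e + ∑ e ∈ E₂, ℓ e = ∑ e ∈ E, ℓ e + 1 := by
        rw [Finset.sum_union hdisj, ← hw, hc.isTrail.weight_eq_sum hCmem,
          ← Finset.sum_filter_add_sum_filter_not E (fun e => ∃ b ∈ B, b ∈ e)]
        ring
      have hs₁ : (fromEdgeSet (E₁ : Set (Sym2 V))).support ⊆
          {w | w ∈ c.support} ∪ (G.support ∩ B) := by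
        intro a has
        obtain ⟨a', ha⟩ := mem_support _ |>.1 has
        rw [fromEdgeSet_adj] at ha
        have ha' := ha.1
        simp only [E₁, Finset.coe_union, Set.mem_union, Finset.mem_coe, Finset.mem_filter,
          E, Set.Finite.mem_toFinset, mem_edgeSet] at ha'
        rcases ha' with ⟨haa, b', hb', hba⟩ | haa
        · by_cases haB : a ∈ B
          · exact Or.inr ⟨⟨a', haa⟩, haB⟩
          · left
            rcases Sym2.mem_iff.1 hba with rfl | rfl
            · exact absurd hb' haB
            · by_contra hac
              exact hadj b' hb' a haB hac haa.symm
        · exact Or.inl (c.fst_mem_support_of_mem_edges ((hCmem _).1 haa))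
      have hs₂ : (fromEdgeSet (E₂ : Set (Sym2 V))).support ⊆ G.support \ B := by
        intro a has
        obtain ⟨a', ha⟩ := mem_support _ |>.1 has
        rw [fromEdgeSet_adj] at ha
        have ha' := ha.1
        simp only [E₂, Finset.mem_coe, Finset.mem_filter, E, Set.Finite.mem_toFinset,
          mem_edgeSet] at ha'
        exact ⟨⟨a', ha'.1⟩, fun haB => ha'.2 ⟨a, haB, by simp⟩⟩
      have n₁ := Set.ncard_le_ncard hs₁
      have n₂ := Set.ncard_le_ncard hs₂
      have n₃ := Set.ncard_union_le {w | w ∈ c.support} (G.support ∩ B)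
      have n₄ := hc.ncard_support_le hCmem
      have n₅ := Set.ncard_inter_add_ncard_sdiff_eq_ncard G.support B
      have n₆ : (((fromEdgeSet (E₁ : Set (Sym2 V))).support.ncard +
        (fromEdgeSet (E₂ : Set (Sym2 V))).support.ncard : ℕ) : ℝ) ≤
          ((C.card + G.support.ncard : ℕ) : ℝ) := by
        exact_mod_cast (by omega)
      push_cast at n₆
      rw [EulerBound]
      change _ ≤ 2 * ∑ e ∈ E, ℓ e
      linarith
    · obtain ⟨a, ha⟩ := hbs
      intro hE
      have : s(b, a) ∈ E₂ := hE ▸ (by simpa [E] using ha)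
      exact (Finset.mem_filter.1 this).2 ⟨b, hb, by simp⟩
  · obtain ⟨a, ha⟩ := hds
    intro hE
    have : s(d, a) ∈ E₁ := hE ▸ (by simpa [E] using ha)
    rcases Finset.mem_union.1 this with h' | h'
    · obtain ⟨b', hb', hb''⟩ := (Finset.mem_filter.1 h').2
      rcases Sym2.mem_iff.1 hb'' with rfl | rfl
      · exact hdB hb'
      · exact hadj b' hb' d hdB hdc ha.symm
    · exact hdc (c.fst_mem_support_of_mem_edges ((hCmem _).1 h'))

/-- A graph with an edge of weight at least one half satisfies the bound if all smaller graphs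
do. -/
lemma eulerBound_of_half_le (h : G.CycleWeightGeOne ℓ) (h0 : ∀ e, 0 ≤ ℓ e) (hac : ¬ G.IsAcyclic)
    (ih : ∀ H : SimpleGraph V, H ≤ G → H.edgeSet.ncard < G.edgeSet.ncard → ¬ H.IsAcyclic →
      H.EulerBound ℓ) {e : Sym2 V} (he : e ∈ G.edgeSet) (hhalf : 1 / 2 ≤ ℓ e) :
    G.EulerBound ℓ := by
  classical
  have hle : G.deleteEdges {e} ≤ G := deleteEdges_le _
  have hcard : (G.deleteEdges {e}).edgeSet.ncard + 1 = G.edgeSet.ncard := by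
    rw [edgeSet_deleteEdges]
    exact Set.ncard_sdiff_singleton_add_one he
  have hsupp : (G.deleteEdges {e}).support.ncard ≤ G.support.ncard :=
    Set.ncard_le_ncard (support_mono hle)
  have hcard' : ((G.deleteEdges {e}).edgeSet.ncard : ℝ) + 1 = G.edgeSet.ncard := by
    exact_mod_cast hcard
  have hsupp' : ((G.deleteEdges {e}).support.ncard : ℝ) ≤ G.support.ncard := by
    exact_mod_cast hsupp
  by_cases hac' : (G.deleteEdges {e}).IsAcyclic
  · simp only [IsAcyclic] at hac
    push Not at hac
    obtain ⟨v, c, hc⟩ := hac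
    have hone : 1 ≤ ∑ e ∈ G.edgeSet.toFinite.toFinset, ℓ e := by
      refine (h v c hc).trans ?_
      rw [hc.isTrail.weight_eq_sum (C := c.edges.toFinset) (by simp)]
      refine Finset.sum_le_sum_of_subset_of_nonneg (fun f hf => ?_) fun f _ _ => h0 f
      simpa using c.edges_subset_edgeSet (by simpa using hf)
    have hne : (G.deleteEdges {e}).edgeSet.Nonempty := by
      rw [← Set.ncard_pos]
      have h3 : 3 ≤ c.edges.toFinset.card := by
        rw [List.toFinset_card_of_nodup hc.edges_nodup, Walk.length_edges]
        exact hc.three_le_length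
      have : c.edges.toFinset.card ≤ G.edgeSet.ncard := by
        rw [← Set.ncard_coe_finset]
        exact Set.ncard_le_ncard fun f hf => c.edges_subset_edgeSet (by simpa using hf)
      omega
    have hlt := hac'.ncard_edgeSet_lt hne
    have hle : (G.edgeSet.ncard : ℝ) ≤ G.support.ncard := by exact_mod_cast (by omega)
    rw [EulerBound]
    linarith
  · have := ih _ hle (by omega) hac'
    rw [EulerBound] at this ⊢
    have hsum : ∑ f ∈ G.edgeSet.toFinite.toFinset, ℓ f =
        ℓ e + ∑ f ∈ (G.deleteEdges {e}).edgeSet.toFinite.toFinset, ℓ f := by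
      rw [← Finset.add_sum_erase _ _ (show e ∈ G.edgeSet.toFinite.toFinset by simpa using he)]
      congr 2
      ext f
      simp [edgeSet_deleteEdges, and_comm]
    rw [hsum]
    linarith

/-- If every cycle of a planar graph has weight at least one, then the total weight of the edges
is at least half the number of faces. -/
theorem IsPlanar.eulerBound (hG : G.IsPlanar) (h : G.CycleWeightGeOne ℓ) (h0 : ∀ e, 0 ≤ ℓ e)
    (hac : ¬ G.IsAcyclic) : G.EulerBound ℓ := by
  classical
  cases nonempty_fintype V
  induction hn : G.edgeSet.ncard using Nat.strong_induction_on generalizing G ℓ with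
  | _ n ih =>
  subst hn
  let 𝒞 : Finset (Finset (Sym2 V)) :=
    {C | ∃ (v : V) (c : G.Walk v v), c.IsCycle ∧ ∀ e, e ∈ C ↔ e ∈ c.edges}
  let ℓ₀ : Sym2 V → ℝ := fun e => if e ∈ G.edgeSet then ℓ e else 0
  obtain ⟨ℓ', h0', hf, hle, hcard⟩ := exists_card_support_le_card_tight 𝒞 ℓ₀
    (fun e => by simp only [ℓ₀]; split_ifs <;> simp [h0]) (by
      intro C hC
      obtain ⟨v, c, hc, hC⟩ := (Finset.mem_filter.1 hC).2
      refine (h v c hc).trans_eq ?_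
      rw [hc.isTrail.weight_eq_sum hC]
      refine Finset.sum_congr rfl fun e he => ?_
      simp [ℓ₀, c.edges_subset_edgeSet ((hC e).1 he)])
  have h' : G.CycleWeightGeOne ℓ' := by
    intro v c hc
    rw [hc.isTrail.weight_eq_sum (C := c.edges.toFinset) (by simp)]
    exact hf _ (Finset.mem_filter.2 ⟨Finset.mem_univ _, v, c, hc, by simp⟩)
  have ih' : ∀ H : SimpleGraph V, H ≤ G → H.edgeSet.ncard < G.edgeSet.ncard → ¬ H.IsAcyclic →
      H.EulerBound ℓ' := fun H hH hlt hH' => ih _ hlt (hG.mono hH) (h'.mono hH) h0' hH' rfl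
  suffices G.EulerBound ℓ' by
    rw [EulerBound] at this ⊢
    have h1 : ∑ e ∈ G.edgeSet.toFinite.toFinset, ℓ' e ≤ ∑ e, ℓ' e :=
      Finset.sum_le_sum_of_subset_of_nonneg (Finset.subset_univ _) fun e _ _ => h0' e
    have h2 : ∑ e, ℓ₀ e = ∑ e ∈ G.edgeSet.toFinite.toFinset, ℓ e := by
      simp only [ℓ₀]
      rw [← Finset.sum_filter]
      congr 1
      ext e
      simp
    linarith
  by_cases hhalf : ∃ e ∈ G.edgeSet, 1 / 2 ≤ ℓ' e
  · obtain ⟨e, he, hhalf⟩ := hhalf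
    exact eulerBound_of_half_le h' h0' hac ih' he hhalf
  push Not at hhalf
  by_cases hns : ∀ (v : V) (c : G.Walk v v), c.IsCycle → c.weight ℓ' = 1 →
      G.NonSeparating c.support
  swap
  · push Not at hns
    obtain ⟨v, c, hc, hw, hsep⟩ := hns
    exact eulerBound_of_not_nonSeparating ih' hc hw hsep
  exfalso
  let P : Finset (Sym2 V) := {e | ℓ' e ≠ 0}
  let 𝒯 : Finset (Finset (Sym2 V)) := {C ∈ 𝒞 | ∑ e ∈ C, ℓ' e = 1}
  have hpos : ∀ e ∈ P, 0 < ℓ' e := fun e he =>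
    lt_of_le_of_ne (h0' e) (Finset.mem_filter.1 he).2.symm
  have h𝒯 : ∀ C ∈ 𝒯, G.IsTightCycle ℓ' C := by
    intro C hC
    obtain ⟨hC, hC1⟩ := Finset.mem_filter.1 hC
    obtain ⟨v, c, hc, hC⟩ := (Finset.mem_filter.1 hC).2
    exact ⟨v, c, hc, hC, by rw [hc.isTrail.weight_eq_sum hC, hC1]⟩
  have hthree : ∀ C ∈ 𝒯, 3 ≤ (P.filter (· ∈ C)).card := by
    intro C hC
    obtain ⟨hC', hC1⟩ := Finset.mem_filter.1 hC
    obtain ⟨v, c, hc, hCc⟩ := (Finset.mem_filter.1 hC').2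
    have hsum : ∑ e ∈ P.filter (· ∈ C), ℓ' e = 1 := by
      rw [← hC1]
      refine Finset.sum_subset (fun e he => (Finset.mem_filter.1 he).2) fun e he he' => ?_
      by_contra hne
      exact he' (by simp [P, he, hne])
    by_contra! hlt
    have : ∑ e ∈ P.filter (· ∈ C), ℓ' e < 1 := by
      have hlt' : ∀ e ∈ P.filter (· ∈ C), ℓ' e < 1 / 2 := fun e he =>
        hhalf e (c.edges_subset_edgeSet ((hCc e).1 (Finset.mem_filter.1 he).2))
      rcases (P.filter (· ∈ C)).eq_empty_or_nonempty with he | he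
      · rw [he] at hsum
        simp at hsum
      · refine (Finset.sum_lt_sum_of_nonempty he hlt').trans_le ?_
        rw [Finset.sum_const, nsmul_eq_mul]
        have : ((P.filter (· ∈ C)).card : ℝ) ≤ 2 := by exact_mod_cast (by omega)
        linarith
    linarith
  have htwo : ∀ e ∈ P, (𝒯.filter (e ∈ ·)).card ≤ 2 := fun e he =>
    hG.card_tightCycles_le_two h' h0' hhalf hns (hpos e he) fun C hC =>
      ⟨h𝒯 C (Finset.mem_filter.1 hC).1, (Finset.mem_filter.1 hC).2⟩
  have hdouble := Finset.sum_card_bipartiteAbove_eq_sum_card_bipartiteBelow (s := P) (t := 𝒯)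
    (fun e C => e ∈ C)
  have hle₁ : ∑ e ∈ P, (𝒯.filter (e ∈ ·)).card ≤ P.card * 2 := by
    simpa using Finset.sum_le_card_nsmul _ _ _ htwo
  have hle₂ : 𝒯.card * 3 ≤ ∑ C ∈ 𝒯, (P.filter (· ∈ C)).card := by
    simpa using Finset.card_nsmul_le_sum _ _ _ hthree
  simp only [Finset.bipartiteAbove, Finset.bipartiteBelow] at hdouble
  have hP : 0 < P.card := by
    rw [Finset.card_pos]
    simp only [IsAcyclic] at hac
    push Not at hac
    obtain ⟨v, c, hc⟩ := hac
    by_contra! hP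
    have h1 := h' v c hc
    rw [hc.isTrail.weight_eq_sum (C := c.edges.toFinset) (by simp), Finset.sum_eq_zero] at h1
    · linarith
    · intro e _
      by_contra hne
      have : e ∈ P := by simp [P, hne]
      simp [hP] at this
  change P.card ≤ 𝒯.card at hcard
  omega

end EulerBound

end SimpleGraph

lemma List.exists_length_maximal {α : Type*} {P : List α → Prop} {N : ℕ}
    (hP : ∀ l, P l → l.length ≤ N) (hne : ∃ l, P l) :
    ∃ l, P l ∧ ∀ l', P l' → l'.length ≤ l.length := by
  classical
  obtain ⟨l₀, h₀⟩ := hne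
  obtain ⟨l, hl, hlen⟩ := Nat.findGreatest_spec (P := fun n => ∃ l, P l ∧ l.length = n)
    (hP l₀ h₀) ⟨l₀, h₀, rfl⟩
  refine ⟨l, hl, fun l' hl' => ?_⟩
  rw [hlen]
  exact Nat.le_findGreatest (hP l' hl') ⟨l', hl', rfl⟩

namespace SimpleGraph

section Discharging

variable {V : Type*} {G : SimpleGraph V} {N : ℕ}

namespace Walk

lemma weight_const {u v : V} (p : G.Walk u v) (a : ℝ) : p.weight (fun _ => a) = p.length * a := by
  simp [weight]

lemma exists_support_eq {l : List V} (hl : l.IsChain G.Adj) {a b : V} (ha : ∃ r, l = a :: r)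
    (hb : ∃ r, l = r ++ [b]) : ∃ p : G.Walk a b, p.support = l := by
  obtain ⟨r, rfl⟩ := ha
  obtain ⟨r', hr'⟩ := hb
  have hlast : (a :: r).getLast (by simp) = b := by simp [hr']
  subst hlast
  exact ⟨ofSupport _ _ hl, support_ofSupport _ hl⟩

end Walk

lemma lt_length_add_length_of_isPath (hg : ∀ (v : V) (c : G.Walk v v), c.IsCycle → N < c.length)
    {u v : V} {p q : G.Walk u v} (hp : p.IsPath) (hq : q.IsPath) (hne : p.support ≠ q.support) :
    N < p.length + q.length := by
  have hN : (0 : ℝ) < N + 1 := by positivity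
  have h : G.CycleWeightGeOne fun _ => 1 / ((N : ℝ) + 1) := by
    intro v c hc
    rw [Walk.weight_const, mul_one_div, le_div_iff₀ hN, one_mul]
    exact_mod_cast hg v c hc
  have := h.one_le_weight_add_weight (fun _ => by positivity) hp hq fun e => hne (e ▸ rfl)
  rw [Walk.weight_const, Walk.weight_const, ← add_mul, mul_one_div, le_div_iff₀ hN, one_mul] at this
  exact_mod_cast this

/-- A vertex of degree two is connected through each of its edges to a vertex of degree at least
three. -/
lemma exists_three_le_ncard_of_adj (hmin : ∀ v, 2 ≤ (G.neighborSet v).ncard)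
    (hN : ∀ l : List V, l.IsChain G.Adj → l.Nodup → (∀ x ∈ l, (G.neighborSet x).ncard = 2) →
      2 * l.length ≤ N)
    (hg : ∀ (v : V) (c : G.Walk v v), c.IsCycle → N + 1 < c.length) {w u : V}
    (hw : (G.neighborSet w).ncard = 2) (hwu : G.Adj u w) :
    ∃ (z : V) (p : G.Walk z w), p.IsPath ∧ z ≠ w ∧ 3 ≤ (G.neighborSet z).ncard ∧
      2 * p.length ≤ N ∧ (∀ x ∈ p.support, x ≠ z → (G.neighborSet x).ncard = 2) ∧
      ∃ r, p.support = r ++ [u, w] := by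
  let P : List V → Prop := fun l => l.IsChain G.Adj ∧ l.Nodup ∧ (∃ r, l = r ++ [u, w]) ∧
    ∀ x ∈ l.tail, (G.neighborSet x).ncard = 2
  have hlen : ∀ l, P l → 2 * (l.length - 1) ≤ N := by
    rintro l ⟨h1, h2, -, h3⟩
    simpa using hN l.tail h1.tail h2.tail h3
  obtain ⟨l, ⟨hl1, hl2, ⟨r, hr⟩, hl3⟩, hmax⟩ := List.exists_length_maximal (P := P) (N := N + 1)
    (fun l hl => by have := hlen l hl; omega)
    ⟨[u, w], by simpa using hwu, by simpa using hwu.ne, ⟨[], rfl⟩, by simpa using hw⟩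
  have hlen' := hlen l ⟨hl1, hl2, ⟨r, hr⟩, hl3⟩
  obtain ⟨z, p, t, rfl⟩ : ∃ z p t, l = z :: p :: t := by
    match l, hr with
    | [], hr => simp at hr
    | [a], hr =>
      have := congrArg List.length hr
      simp at this
    | z :: p :: t, _ => exact ⟨z, p, t, rfl⟩
  have hwmem : w ∈ p :: t := by
    cases r with
    | nil =>
      simp only [List.nil_append, List.cons.injEq] at hr
      simp [hr]
    | cons a r =>
      simp only [List.cons_append, List.cons.injEq] at hr
      simp [hr.2]
  obtain ⟨q, hq⟩ := Walk.exists_support_eq (b := w) hl1 ⟨_, rfl⟩ ⟨r ++ [u], by simp [hr]⟩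
  have hqp : q.IsPath := by rw [Walk.isPath_def, hq]; exact hl2
  have hql : q.length + 1 = (z :: p :: t).length := by rw [← hq, Walk.length_support]
  refine ⟨z, q, hqp, ?_, ?_, ?_, ?_, r, hq.trans hr⟩
  · rintro rfl
    exact (List.nodup_cons.1 hl2).1 hwmem
  · by_contra! hlt
    have hz : (G.neighborSet z).ncard = 2 := by have := hmin z; omega
    obtain ⟨y, hy, hyp⟩ := Set.exists_ne_of_one_lt_ncard (by omega : 1 < (G.neighborSet z).ncard) p
    rw [mem_neighborSet] at hy
    by_cases hyl : y ∈ z :: p :: t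
    · obtain ⟨A, B, hAB⟩ := List.append_of_mem hyl
      obtain ⟨q₁, q₂, rfl, hq₁, -⟩ := q.exists_eq_append_of_support_eq (hq.trans hAB)
      have hne : q₁.support ≠ (Walk.cons hy Walk.nil).support := by
        intro h
        rw [hq₁] at h
        simp only [Walk.support_cons, Walk.support_nil] at h
        obtain rfl : A = [z] := by
          have : A ++ [y] = [z] ++ [y] := h
          exact List.append_cancel_right this
        simp only [List.cons_append, List.nil_append, List.cons.injEq] at hAB
        exact hyp hAB.2.1.symm
      have := lt_length_add_length_of_isPath hg hqp.of_append_left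
        (show (Walk.cons hy Walk.nil).IsPath by simpa using hy.ne) hne
      simp only [Walk.length_cons, Walk.length_nil, Walk.length_append, List.length_cons]
        at this hql hlen'
      omega
    · have := hmax (y :: z :: p :: t) ⟨?_, List.nodup_cons.2 ⟨hyl, hl2⟩, ⟨y :: r, by simp [hr]⟩, ?_⟩
      · simp at this
      · exact List.isChain_cons_cons.2 ⟨hy.symm, hl1⟩
      · intro x hx
        simp only [List.tail_cons, List.mem_cons] at hx
        rcases hx with rfl | hx
        · exact hz
        · exact hl3 x (by simpa using hx)
  · rw [← hql] at hlen'
    simpa using hlen'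
  · intro x hx hxz
    rw [hq, List.mem_cons] at hx
    exact hl3 x (by simpa using hx.resolve_left hxz)

/-- Each vertex of degree two is a weak-neighbor of two vertices of degree at least three. -/
lemma exists_two_isWeakNbr (hmin : ∀ v, 2 ≤ (G.neighborSet v).ncard)
    (hN : ∀ l : List V, l.IsChain G.Adj → l.Nodup → (∀ x ∈ l, (G.neighborSet x).ncard = 2) →
      2 * l.length ≤ N)
    (hg : ∀ (v : V) (c : G.Walk v v), c.IsCycle → N + 1 < c.length) {w : V}
    (hw : (G.neighborSet w).ncard = 2) :
    ∃ z₁ z₂, z₁ ≠ z₂ ∧ (3 ≤ (G.neighborSet z₁).ncard ∧ G.IsWeakNbr z₁ w) ∧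
      3 ≤ (G.neighborSet z₂).ncard ∧ G.IsWeakNbr z₂ w := by
  obtain ⟨u₁, u₂, hu, hn⟩ := Set.ncard_eq_two.1 hw
  have hu₁ : G.Adj u₁ w := by
    have : u₁ ∈ G.neighborSet w := by simp [hn]
    exact this.symm
  have hu₂ : G.Adj u₂ w := by
    have : u₂ ∈ G.neighborSet w := by simp [hn]
    exact this.symm
  obtain ⟨z₁, p₁, hp₁, hz₁, hd₁, hl₁, hi₁, r₁, hr₁⟩ :=
    exists_three_le_ncard_of_adj hmin hN hg hw hu₁
  obtain ⟨z₂, p₂, hp₂, hz₂, hd₂, hl₂, hi₂, r₂, hr₂⟩ :=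
    exists_three_le_ncard_of_adj hmin hN hg hw hu₂
  refine ⟨z₁, z₂, ?_, ⟨hd₁, hz₁, p₁, hp₁, fun x hx h _ => hi₁ x hx h⟩,
    hd₂, hz₂, p₂, hp₂, fun x hx h _ => hi₂ x hx h⟩
  rintro rfl
  have := lt_length_add_length_of_isPath hg hp₁ hp₂ (fun h => hu ?_)
  · omega
  · rw [hr₁, hr₂] at h
    have h' : r₁ ++ [u₁] ++ [w] = r₂ ++ [u₂] ++ [w] := by simpa using h
    have h'' := List.append_inj_left' h' rfl
    simpa using List.append_inj_right' h'' rfl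

/-- A vertex of degree `d` has at most `d * N / 2` weak-neighbors of degree two, if no path contains
more than `N / 2` consecutive vertices of degree two. -/
lemma ncard_isWeakNbr_le [Finite V]
    (hN : ∀ l : List V, l.IsChain G.Adj → l.Nodup → (∀ x ∈ l, (G.neighborSet x).ncard = 2) →
      2 * l.length ≤ N) (v : V) :
    2 * {w | G.IsWeakNbr v w ∧ (G.neighborSet w).ncard = 2}.ncard ≤
      (G.neighborSet v).ncard * N := by
  classical
  let P : V → List V → Prop := fun x l => (v :: l).IsChain G.Adj ∧ (v :: l).Nodup ∧
    (∃ t, l = x :: t) ∧ ∀ y ∈ l, (G.neighborSet y).ncard = 2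
  have hlen : ∀ x l, P x l → 2 * l.length ≤ N := fun x l ⟨h1, h2, _, h3⟩ =>
    hN l (by simpa using h1.tail) (List.nodup_cons.1 h2).2 h3
  have hcomp : ∀ x l l', P x l → P x l' → l.length ≤ l'.length → l <+: l' := by
    rintro x l l' ⟨c1, n1, ⟨t, ht⟩, d1⟩ ⟨c2, n2, ⟨t', ht'⟩, d2⟩ hle
    obtain ⟨s, r, r', h1, h2, h3⟩ := exists_maximal_common_start l l'
    cases r with
    | nil => exact ⟨r', by rw [h2, h1]; simp⟩
    | cons a r =>
      cases r' with
      | nil =>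
        rw [h1, h2] at hle
        simp at hle
      | cons b r' =>
        exfalso
        have hab : a ≠ b := by simpa using h3
        rcases List.eq_nil_or_concat' s with rfl | ⟨s', z, rfl⟩
        · have e1 := h1.symm.trans ht
          have e2 := h2.symm.trans ht'
          simp only [List.nil_append, List.cons.injEq] at e1 e2
          exact hab (e1.1.trans e2.1.symm)
        · obtain ⟨A, y, hA⟩ : ∃ A y, v :: s' = A ++ [y] :=
            ⟨_, _, (List.dropLast_append_getLast (List.cons_ne_nil v s')).symm⟩
          have e1 : v :: l = A ++ y :: z :: a :: r := by
            rw [h1, ← List.cons_append, ← List.cons_append, hA]; simp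
          have e2 : v :: l' = A ++ y :: z :: b :: r' := by
            rw [h2, ← List.cons_append, ← List.cons_append, hA]; simp
          rw [e1] at c1 n1
          rw [e2] at c2 n2
          have c1' := (List.isChain_append.1 c1).2.1
          have c2' := (List.isChain_append.1 c2).2.1
          have n1' := (List.nodup_append.1 n1).2.1
          have n2' := (List.nodup_append.1 n2).2.1
          simp only [List.isChain_cons_cons] at c1' c2'
          simp only [List.nodup_cons, List.mem_cons, not_or] at n1' n2'
          have hz : (G.neighborSet z).ncard = 2 := d1 z (by simp [h1])
          have h3 : ({y, a, b} : Set V).ncard = 3 :=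
            Set.ncard_eq_three.2 ⟨y, a, b, n1'.1.2.1, n2'.1.2.1, hab, rfl⟩
          have hsub : ({y, a, b} : Set V) ⊆ G.neighborSet z := by
            rintro q (rfl | rfl | rfl)
            · exact c1'.1.symm
            · exact c1'.2.1
            · exact c2'.2.1
          have := Set.ncard_le_ncard hsub
          omega
  let W : V → Set V := fun x => {w | ∃ l, P x l ∧ w ∈ l}
  have hW : ∀ x, 2 * (W x).ncard ≤ N := by
    intro x
    by_cases hne : ∃ l, P x l
    · obtain ⟨l, hl, hmax⟩ := List.exists_length_maximal (P := P x) (N := N)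
        (fun l hl => by have := hlen x l hl; omega) hne
      have hsub : W x ⊆ (l.toFinset : Set V) := by
        rintro w ⟨l', hl', hw⟩
        simpa using (hcomp x l' l hl' hl (hmax l' hl')).subset hw
      have h1 := Set.ncard_le_ncard hsub
      rw [Set.ncard_coe_finset] at h1
      have h2 := l.toFinset_card_le
      have h3 := hlen x l hl
      omega
    · have : W x = ∅ := by
        ext w
        simp only [W, Set.mem_ofPred_eq, Set.mem_empty_iff_false, iff_false]
        rintro ⟨l, hl, -⟩
        exact hne ⟨l, hl⟩
      simp [this]
  have hsub : {w | G.IsWeakNbr v w ∧ (G.neighborSet w).ncard = 2} ⊆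
      ⋃ x ∈ (G.neighborSet v).toFinite.toFinset, W x := by
    rintro w ⟨⟨hne, p, hp, hi⟩, hw⟩
    cases p with
    | nil => exact absurd rfl hne
    | @cons _ x _ h p =>
      simp only [Set.Finite.mem_toFinset, Set.mem_iUnion]
      refine ⟨x, h, p.support, ⟨(Walk.cons h p).isChain_adj_support, hp.support_nodup,
        ⟨_, p.cons_tail_support.symm⟩, fun y hy => ?_⟩, p.end_mem_support⟩
      by_cases hyw : y = w
      · rw [hyw, hw]
      · refine hi y (by simp [hy]) ?_ hyw
        rintro rfl
        exact ((Walk.cons_isPath_iff _ _).1 hp).2 hy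
  have h1 := (Set.ncard_le_ncard hsub (Set.toFinite _)).trans (Finset.set_ncard_biUnion_le _ W)
  have h2 : ∑ x ∈ (G.neighborSet v).toFinite.toFinset, 2 * (W x).ncard ≤
      (G.neighborSet v).ncard * N := by
    rw [Set.ncard_eq_toFinset_card _ (G.neighborSet v).toFinite]
    simpa using Finset.sum_le_card_nsmul _ _ _ fun x _ => hW x
  rw [← Finset.mul_sum] at h2
  omega

end Discharging

end SimpleGraph

namespace SimpleGraph

variable {V : Type*} {G : SimpleGraph V}

/-- Double counting of the pairs consisting of a vertex of degree at least three and one of its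
weak-neighbors of degree two. -/
lemma card_mul_le_sum_degree [Fintype V] {k : ℕ} (hmin : ∀ v, 2 ≤ (G.neighborSet v).ncard)
    (h3 : ∀ v, (G.neighborSet v).ncard = 3 →
      {w | G.IsWeakNbr v w ∧ (G.neighborSet w).ncard = 2}.ncard ≤ k)
    (hN : ∀ l : List V, l.IsChain G.Adj → l.Nodup → (∀ x ∈ l, (G.neighborSet x).ncard = 2) →
      2 * l.length ≤ k + 1)
    (hg : ∀ v (c : G.Walk v v), c.IsCycle → k + 2 < c.length) :
    2 * (k + 3) * Fintype.card V ≤ (k + 2) * ∑ v, (G.neighborSet v).ncard := by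
  classical
  let d : V → ℕ := fun v => (G.neighborSet v).ncard
  let A : Finset V := {v | d v = 2}
  let B : Finset V := {v | 3 ≤ d v}
  have hdc : 2 * A.card ≤ ∑ v ∈ B, {w | G.IsWeakNbr v w ∧ d w = 2}.ncard := by
    have h := Finset.sum_card_bipartiteAbove_eq_sum_card_bipartiteBelow (s := B) (t := A)
      G.IsWeakNbr
    have hA : ∀ w ∈ A, 2 ≤ (B.bipartiteBelow G.IsWeakNbr w).card := by
      intro w hw
      obtain ⟨z₁, z₂, hne, h₁, h₂⟩ := exists_two_isWeakNbr hmin hN hg (by simpa [A] using hw)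
      exact Finset.one_lt_card.2 ⟨z₁, by simpa [B, Finset.mem_bipartiteBelow] using h₁, z₂,
        by simpa [B, Finset.mem_bipartiteBelow] using h₂, hne⟩
    have h2 := Finset.card_nsmul_le_sum A _ 2 hA
    rw [← h, smul_eq_mul, mul_comm] at h2
    refine h2.trans (Finset.sum_le_sum fun v _ => ?_)
    rw [← Set.ncard_coe_finset]
    refine Set.ncard_le_ncard (fun w hw => ?_) (Set.toFinite _)
    simpa [A, Finset.mem_bipartiteAbove, and_comm] using hw
  have hB : ∀ v ∈ B, {w | G.IsWeakNbr v w ∧ d w = 2}.ncard + 2 * (k + 3) ≤ (k + 2) * d v := by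
    intro v hv
    have hv' : 3 ≤ d v := by simpa [B] using hv
    rcases hv'.eq_or_lt with h | h
    · have := h3 v h.symm
      rw [← h]
      simp only [d]
      omega
    · have h1 : 2 * {w | G.IsWeakNbr v w ∧ d w = 2}.ncard ≤ d v * (k + 1) :=
        ncard_isWeakNbr_le hN v
      have h2 : 4 ≤ d v := h
      nlinarith
  have hsplit : ∀ f : V → ℕ, ∑ v, f v = ∑ v ∈ A, f v + ∑ v ∈ B, f v := by
    intro f
    have : B = Finset.univ.filter fun v => ¬ d v = 2 := by
      ext v
      have : 2 ≤ d v := hmin v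
      simp only [B, Finset.mem_filter, Finset.mem_univ, true_and]
      omega
    rw [this, Finset.sum_filter_add_sum_filter_not]
  have hsumA : ∑ v ∈ A, d v = 2 * A.card := by
    rw [Finset.sum_congr rfl (g := fun _ => 2) fun v hv => by simpa [A] using hv]
    simp [mul_comm]
  have hcard : Fintype.card V = A.card + B.card := by
    simpa using hsplit fun _ => 1
  have hsumB := Finset.sum_le_sum hB
  rw [Finset.sum_add_distrib, ← Finset.mul_sum, ← Finset.mul_sum, Finset.sum_const,
    smul_eq_mul] at hsumB
  have hd : ∑ v, (G.neighborSet v).ncard = 2 * A.card + ∑ v ∈ B, d v := by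
    rw [← hsumA]; exact hsplit d
  rw [hd, hcard]
  nlinarith

lemma sum_ncard_neighborSet [Fintype V] (G : SimpleGraph V) :
    ∑ v, (G.neighborSet v).ncard = 2 * G.edgeSet.ncard := by
  classical
  rw [← coe_edgeFinset, Set.ncard_coe_finset, ← sum_degrees_eq_twice_card_edges]
  refine Finset.sum_congr rfl fun v _ => ?_
  rw [← card_neighborFinset_eq_degree, ← Set.ncard_coe_finset, coe_neighborFinset]

end SimpleGraph

/-- If `G` is a finite nonempty planar graph with minimum degree at
least 2, no connected component of which is a cycle (i.e. every component contains a
vertex of degree `≠ 2`), every degree-3 vertex has at most `k` 2-weak-neighbors, and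
every path contains at most `(k+1)/2` consecutive 2-vertices, then `G` contains a
cycle of length strictly less than `2k+6`. -/
theorem egirth_lt_of_weak_neighbor_conditions (k : ℕ) {V : Type*} [Fintype V] [Nonempty V]
    (G : SimpleGraph V) (hplanar : G.IsPlanar)
    (hmin : ∀ v, 2 ≤ (G.neighborSet v).ncard)
    (hnocyclecomp : ∀ v, ∃ w, G.Reachable v w ∧ (G.neighborSet w).ncard ≠ 2)
    (h3 : ∀ v, (G.neighborSet v).ncard = 3 →
      {w | G.IsWeakNbr v w ∧ (G.neighborSet w).ncard = 2}.ncard ≤ k)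
    (hpath : ∀ (u v : V) (p : G.Walk u v), p.IsPath →
      ∀ l : List V, l <:+: p.support → (∀ x ∈ l, (G.neighborSet x).ncard = 2) →
        (l.length : ℝ) ≤ (k + 1) / 2) :
    G.egirth < ((2 * k + 6 : ℕ) : ℕ∞) := by
  by_contra hge
  rw [not_lt, SimpleGraph.le_egirth] at hge
  have hcyc : ∀ v (c : G.Walk v v), c.IsCycle → 2 * k + 6 ≤ c.length :=
    fun v c hc => by exact_mod_cast hge v c hc
  have hN : ∀ l : List V, l.IsChain G.Adj → l.Nodup → (∀ x ∈ l, (G.neighborSet x).ncard = 2) →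
      2 * l.length ≤ k + 1 := by
    intro l hl hnd hdeg
    rcases eq_or_ne l [] with rfl | hne
    · simp
    have hsupp := SimpleGraph.Walk.support_ofSupport hne hl
    have h := hpath _ _ (SimpleGraph.Walk.ofSupport l hne hl)
      (by rw [SimpleGraph.Walk.isPath_def, hsupp]; exact hnd) l (by rw [hsupp]) hdeg
    have h' : (2 * l.length : ℝ) ≤ k + 1 := by linarith
    exact_mod_cast h'
  have hcount := SimpleGraph.card_mul_le_sum_degree hmin h3 hN
    fun v c hc => by have := hcyc v c hc; omega
  rw [SimpleGraph.sum_ncard_neighborSet] at hcount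
  have hsupp : G.support = Set.univ := by
    ext v
    obtain ⟨w, hw⟩ := Set.nonempty_of_ncard_ne_zero (by have := hmin v; omega :
      (G.neighborSet v).ncard ≠ 0)
    simpa using ⟨w, hw⟩
  have hcardV : G.support.ncard = Fintype.card V := by
    rw [hsupp, Set.ncard_univ, Nat.card_eq_fintype_card]
  have hpos : 0 < Fintype.card V := Fintype.card_pos
  have hle : Fintype.card V ≤ G.edgeSet.ncard := by
    by_contra! hlt
    nlinarith
  have hac : ¬ G.IsAcyclic := fun h => by
    have := h.ncard_edgeSet_lt (Set.nonempty_of_ncard_ne_zero (by omega))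
    omega
  have hkpos : (0 : ℝ) < 2 * k + 6 := by positivity
  have hw : G.CycleWeightGeOne fun _ => (1 : ℝ) / (2 * k + 6) := by
    intro v c hc
    rw [SimpleGraph.Walk.weight_const, mul_one_div, one_le_div hkpos]
    exact_mod_cast hcyc v c hc
  have heuler := hplanar.eulerBound hw (fun _ => by positivity) hac
  rw [SimpleGraph.EulerBound, Finset.sum_const, ← Set.ncard_eq_toFinset_card, hcardV, nsmul_eq_mul,
    mul_one_div, mul_div_assoc', ← sub_nonneg] at heuler
  have hcount' : (2 * (k + 3) * Fintype.card V : ℝ) ≤ (k + 2) * (2 * G.edgeSet.ncard) := by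
    exact_mod_cast hcount
  have h := mul_nonneg heuler hkpos.le
  rw [sub_mul, div_mul_cancel₀ _ hkpos.ne'] at h
  nlinarith
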